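/- Fix 0 < R < 1 and ε > 0 with 1 - R - ε > 0, a positive integer ℓ, a constant ε' with 0 < ε' < R, and a constant η > 0. Set L := ⌊(2ℓ/ε)^{2ℓ/ε}⌋. Let n be sufficiently large (in particular ε'n ≥ 2(L+1)(L+2) and (R-ε')n an integer), and let q be a prime power with q > ((4(L+1))^{4(L+1)}·Rn/ε') · 2^{((log₂ℓ + 2)(L+1) + η)·2(L+1)/ε'}. Then a random Reed–Solomon code of rate R - ε' in F_q^n is (1-R-ε, ℓ, L)-list-recoverable with probability at least 1 - 2^{-ηn}. -/

import Mathlib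

/-- The agreement set `agr(x, S₁,…,Sₙ) = {i : xᵢ ∈ Sᵢ}`. -/
def agr {F : Type*} [DecidableEq F] {n : ℕ} (x : Fin n → F) (S : Fin n → Finset F) :
    Finset (Fin n) :=
  Finset.univ.filter fun i => x i ∈ S i

/-- A code `C ⊆ F^n` is `(ρ, ℓ, L)`-list-recoverable if for every choice of input lists
`S₁,…,Sₙ ⊆ F` of size `ℓ`, the number of codewords in the `ρ`-radius list-recovery ball
is at most `L`. -/
def ListRecoverable {F : Type*} [DecidableEq F] {n : ℕ} (C : Set (Fin n → F))
    (ρ : ℝ) (ℓ L : ℕ) : Prop :=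
  ∀ S : Fin n → Finset F, (∀ i, (S i).card = ℓ) →
    ({x ∈ C | (1 - ρ) * (n : ℝ) ≤ ((agr x S).card : ℝ)}).ncard ≤ L

/-- The Reed–Solomon code of degree `< k` with evaluation points `α₁,…,αₙ`. -/
def RSCode {F : Type*} [Field F] {n : ℕ} (α : Fin n → F) (k : ℕ) : Set (Fin n → F) :=
  {v | ∃ p : Polynomial F, p.degree < (k : WithBot ℕ) ∧ v = fun i => p.eval (α i)}

namespace RSLR
open Module Polynomial

/-- vectors constant on each class of the pattern -/
def patV (K : Type*) [Field K] {b ℓ : ℕ} (φ : Fin b → Option (Fin ℓ)) :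
    Submodule K (Fin b → K) where
  carrier := {x | ∀ a a', φ a ≠ none → φ a = φ a' → x a = x a'}
  add_mem' := by
    intro x y hx hy a a' h1 h2
    simp [hx a a' h1 h2, hy a a' h1 h2]
  zero_mem' := by intro a a' _ _; rfl
  smul_mem' := by
    intro c x hx a a' h1 h2
    simp [hx a a' h1 h2]

/-- vectors of `U` constant on `A` -/
def constOn {K : Type*} [Field K] {b : ℕ} (U : Submodule K (Fin b → K)) (A : Finset (Fin b)) :
    Submodule K (Fin b → K) where
  carrier := {x | x ∈ U ∧ ∀ a ∈ A, ∀ a' ∈ A, x a = x a'}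
  add_mem' := by
    rintro x y ⟨hx, hx'⟩ ⟨hy, hy'⟩
    refine ⟨U.add_mem hx hy, fun a ha a' ha' => ?_⟩
    simp [hx' a ha a' ha', hy' a ha a' ha']
  zero_mem' := ⟨U.zero_mem, fun a _ a' _ => rfl⟩
  smul_mem' := by
    rintro c x ⟨hx, hx'⟩
    refine ⟨U.smul_mem c hx, fun a ha a' ha' => ?_⟩
    simp [hx' a ha a' ha']

lemma exists_info_set {K : Type*} [Field K] {b : ℕ} : ∀ (r : ℕ) (U : Submodule K (Fin b → K)),
    finrank K U = r → ∃ A : Finset (Fin b), A.card ≤ r ∧ ∀ u ∈ U, (∀ a ∈ A, u a = 0) → u = 0 := by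
  intro r
  induction r using Nat.strong_induction_on with
  | _ r ih =>
    intro U hU
    by_cases h0 : U = ⊥
    · exact ⟨∅, by simp, fun u hu _ => by rw [h0] at hu; simpa using hu⟩
    · obtain ⟨u, hu, hu0⟩ := Submodule.exists_mem_ne_zero_of_ne_bot h0
      obtain ⟨a, ha⟩ : ∃ a, u a ≠ 0 := by
        by_contra h; push Not at h; exact hu0 (funext h)
      let U1 : Submodule K (Fin b → K) := U ⊓ LinearMap.ker (LinearMap.proj a : (Fin b → K) →ₗ[K] K)
      have hlt : U1 < U := by
        refine lt_of_le_of_ne inf_le_left ?_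
        intro he
        have : u ∈ U1 := he ▸ hu
        exact ha (by simpa using this.2)
      have hr := Submodule.finrank_lt_finrank_of_lt hlt
      obtain ⟨A, hA, hA'⟩ := ih (finrank K U1) (hU ▸ hr) U1 rfl
      refine ⟨insert a A, (Finset.card_insert_le _ _).trans (by omega), ?_⟩
      intro v hv hv0
      refine hA' v ⟨hv, ?_⟩ (fun c hc => hv0 c (Finset.mem_insert_of_mem hc))
      simpa using hv0 a (Finset.mem_insert_self _ _)

/-- dimension bound for vectors constant on classes, determined by `A`. -/
lemma finrank_pat_le {K : Type*} [Field K] {b ℓ : ℕ} (φ : Fin b → Option (Fin ℓ))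
    (U : Submodule K (Fin b → K)) (A : Finset (Fin b))
    (hA : ∀ u ∈ U, (∀ a ∈ A, u a = 0) → u = 0) :
    finrank K (U ⊓ patV K φ : Submodule K (Fin b → K)) ≤
      ℓ + (A.filter (fun a => φ a = none)).card := by
  classical
  -- evaluation at class representatives and at unclassified points
  let rep : Fin ℓ → (Fin b → K) →ₗ[K] K := fun j =>
    if h : ∃ a, φ a = some j then LinearMap.proj h.choose else 0
  let T : (U ⊓ patV K φ : Submodule K (Fin b → K)) →ₗ[K]
      ((Fin ℓ → K) × ((A.filter (fun a => φ a = none)) → K)) :=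
    (LinearMap.prod (LinearMap.pi rep) (LinearMap.pi fun a => LinearMap.proj a.1)).comp
      (Submodule.subtype _)
  have hT : Function.Injective T := by
    rw [← LinearMap.ker_eq_bot, LinearMap.ker_eq_bot']
    rintro ⟨u, hu⟩ h
    have h1 := congrArg Prod.fst h
    have h2 := congrArg Prod.snd h
    ext1
    apply hA u hu.1
    intro a ha
    rcases hφ : φ a with _ | j
    · have := congrFun h2 ⟨a, by simp [ha, hφ]⟩
      simpa [T] using this
    · have := congrFun h1 j
      have hex : ∃ a, φ a = some j := ⟨a, hφ⟩
      have h3 : u hex.choose = 0 := by simpa [T, rep, hex] using this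
      rw [← h3]
      exact hu.2 a _ (by simp [hφ]) (by rw [hφ, hex.choose_spec])
  have := LinearMap.finrank_le_finrank_of_injective hT
  rw [finrank_prod, finrank_fintype_fun_eq_card, finrank_fintype_fun_eq_card, Fintype.card_fin,
    Fintype.card_coe] at this
  exact this

theorem list_bound {K : Type*} [Field K] {b ℓ n : ℕ} (hn : 0 < n) (φ : Fin n → Fin b → Option (Fin ℓ))
    (R ε : ℝ) (hε : 0 < ε) (hℓε : 1 ≤ ℓ / ε) 
    (hagr : ∀ a, (R + ε) * n ≤ ((Finset.univ.filter fun i => φ i a ≠ none).card : ℝ))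
    (U : Submodule K (Fin b → K))
    (hU : ∀ U' ≤ U, (1 - R) * n * ((finrank K U : ℝ) - finrank K U') ≤
      ∑ i, ((finrank K (U ⊓ patV K (φ i) : Submodule K (Fin b → K)) : ℝ)
        - finrank K (U' ⊓ patV K (φ i) : Submodule K (Fin b → K))))
    (hd : ∀ a a', a ≠ a' → ∃ u ∈ U, u a ≠ u a') :
    ε * finrank K U ≤ ℓ ∧ (b : ℝ) ≤ (ℓ / ε) ^ finrank K U := by
  classical
  have hnR : (0 : ℝ) < n := by exact_mod_cast hn
  constructor
  · obtain ⟨A, hAc, hA⟩ := exists_info_set _ U rfl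
    have h0 := hU ⊥ bot_le
    have hz : ∀ W : Submodule K (Fin b → K), finrank K (⊥ ⊓ W : Submodule K (Fin b → K)) = 0 := by
      intro W
      rw [bot_inf_eq]
      exact finrank_bot K _
    simp only [hz, finrank_bot, Nat.cast_zero, sub_zero] at h0
    have h1 : ∑ i, ((finrank K (U ⊓ patV K (φ i) : Submodule K (Fin b → K)) : ℝ)) ≤
        ∑ i, ((ℓ : ℝ) + ((A.filter (fun a => φ i a = none)).card : ℝ)) := by
      apply Finset.sum_le_sum
      intro i _
      exact_mod_cast finrank_pat_le (φ i) U A hA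
    have h2 : ∑ i, ((A.filter (fun a => φ i a = none)).card : ℝ) =
        ∑ a ∈ A, ((Finset.univ.filter fun i => φ i a = none).card : ℝ) := by
      simp only [Finset.card_filter, Nat.cast_sum]
      rw [Finset.sum_comm]
    have h3 : ∀ a ∈ A, ((Finset.univ.filter fun i => φ i a = none).card : ℝ) ≤ (1 - R - ε) * n := by
      intro a _
      have := Finset.card_filter_add_card_filter_not (s := (Finset.univ : Finset (Fin n))) (fun i => φ i a = none)
      have h4 := hagr a
      have h5 : ((Finset.univ.filter fun i => φ i a = none).card : ℝ) + ((Finset.univ.filter fun i => φ i a ≠ none).card : ℝ) = n := by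
        have h6 : (Finset.univ : Finset (Fin n)).card = n := by simp
        rw [h6] at this
        exact_mod_cast this
      linarith
    have h4 := Finset.sum_le_sum h3
    rw [Finset.sum_const, nsmul_eq_mul] at h4
    rw [Finset.sum_add_distrib, h2] at h1
    simp only [Finset.sum_const, Finset.card_univ, Fintype.card_fin, nsmul_eq_mul] at h1
    have hAr : (A.card : ℝ) ≤ finrank K U := by exact_mod_cast hAc
    by_cases hs : 0 ≤ 1 - R - ε
    · have : (A.card : ℝ) * ((1 - R - ε) * n) ≤ finrank K U * ((1 - R - ε) * n) :=
        mul_le_mul_of_nonneg_right hAr (by positivity)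
      have h7 : n * (ε * finrank K U) ≤ n * (ℓ : ℝ) := by nlinarith
      exact le_of_mul_le_mul_left h7 hnR
    · -- then no codeword possible : b = 0
      have hb : IsEmpty (Fin b) := by
        constructor
        intro a
        have h5 := hagr a
        have h6 : ((Finset.univ.filter fun i => φ i a ≠ none).card : ℝ) ≤ n := by
          have := Finset.card_filter_le (Finset.univ : Finset (Fin n)) (fun i => φ i a ≠ none)
          simp only [Finset.card_univ, Fintype.card_fin] at this
          exact_mod_cast this
        nlinarith
      have : finrank K U = 0 := finrank_zero_of_subsingleton
      simp [this]
  · -- induction on codimension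
    have key : ∀ t : ℕ, ∀ A : Finset (Fin b), finrank K U ≤ finrank K (constOn U A) + t →
        (A.card : ℝ) ≤ (ℓ / ε) ^ t := by
      intro t
      induction t using Nat.strong_induction_on with
      | _ t ih =>
      intro A hA
      by_cases hA1 : A.card ≤ 1
      · calc (A.card : ℝ) ≤ 1 := by exact_mod_cast hA1
          _ ≤ _ := one_le_pow₀ hℓε
      push Not at hA1
      have hle : constOn U A ≤ U := fun x hx => hx.1
      have hlt : constOn U A < U := by
        refine lt_of_le_of_ne hle ?_
        intro he
        obtain ⟨a, ha, a', ha', hne⟩ := Finset.one_lt_card.1 hA1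
        obtain ⟨u, hu, huu⟩ := hd a a' hne
        rw [← he] at hu
        exact huu (hu.2 a ha a' ha')
      have hfl := Submodule.finrank_lt_finrank_of_lt hlt
      have ht : 1 ≤ t := by omega
      have hm := hU _ hle
      set c : ℝ := (finrank K U : ℝ) - finrank K (constOn U A) with hc
      have hcpos : 0 < c := by
        rw [hc, sub_pos]; exact_mod_cast hfl
      let G : Finset (Fin n) := Finset.univ.filter fun i => ¬ (U ⊓ patV K (φ i) ≤ constOn U A)
      have hG : (1 - R) * n ≤ G.card := by
        have h1 : ∑ i, ((finrank K (U ⊓ patV K (φ i) : Submodule K (Fin b → K)) : ℝ)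
        - finrank K (constOn U A ⊓ patV K (φ i) : Submodule K (Fin b → K))) ≤
            ∑ i, if i ∈ G then c else 0 := by
          apply Finset.sum_le_sum
          intro i _
          split_ifs with hi
          · -- submodularity
            have h2 := Submodule.finrank_sup_add_finrank_inf_eq (U ⊓ patV K (φ i)) (constOn U A)
            have h3 : (U ⊓ patV K (φ i)) ⊓ constOn U A = constOn U A ⊓ patV K (φ i) := by
              rw [inf_right_comm, inf_eq_right.2 hle]
            rw [h3] at h2
            have h4 : finrank K ((U ⊓ patV K (φ i)) ⊔ constOn U A : Submodule K (Fin b → K)) ≤ finrank K U :=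
              Submodule.finrank_mono (sup_le inf_le_left hle)
            have h5 : finrank K (U ⊓ patV K (φ i) : Submodule K (Fin b → K)) + finrank K (constOn U A) ≤
              finrank K U + finrank K (constOn U A ⊓ patV K (φ i) : Submodule K (Fin b → K)) := by omega
            have h6 : (finrank K (U ⊓ patV K (φ i) : Submodule K (Fin b → K)) : ℝ) + finrank K (constOn U A) ≤
              finrank K U + finrank K (constOn U A ⊓ patV K (φ i) : Submodule K (Fin b → K)) := by
              exact_mod_cast h5
            rw [hc]; linarith
          · have hi' : U ⊓ patV K (φ i) ≤ constOn U A := by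
              by_contra h; exact hi (by simp [G, h])
            have : U ⊓ patV K (φ i) ≤ constOn U A ⊓ patV K (φ i) := le_inf hi' inf_le_right
            have h2 := Submodule.finrank_mono (R := K) this
            have : (finrank K (U ⊓ patV K (φ i) : Submodule K (Fin b → K)) : ℝ) ≤ 
              finrank K (constOn U A ⊓ patV K (φ i) : Submodule K (Fin b → K)) := by exact_mod_cast h2
            linarith
        have h2 : (∑ i, if i ∈ G then c else 0) = G.card * c := by
          rw [Finset.sum_ite_mem]; simp
        have h3 : (1 - R) * n * c ≤ G.card * c := by linarith
        exact le_of_mul_le_mul_right h3 hcpos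
      -- double count
      have hlow : (A.card : ℝ) * (ε * n) ≤ ∑ a ∈ A, ((G.filter fun i => φ i a ≠ none).card : ℝ) := by
        rw [← nsmul_eq_mul, ← Finset.sum_const]
        apply Finset.sum_le_sum
        intro a _
        have h1 := hagr a
        have h2 : (Finset.univ.filter fun i => φ i a ≠ none).card + G.card ≤ n + (G.filter fun i => φ i a ≠ none).card := by
          have h3 := Finset.card_union_add_card_inter (Finset.univ.filter fun i => φ i a ≠ none) G
          have h4 : (Finset.univ.filter fun i => φ i a ≠ none) ∩ G = (G.filter fun i => φ i a ≠ none) := by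
            ext i; simp [and_comm]
          have h5 := Finset.card_le_univ ((Finset.univ.filter fun i => φ i a ≠ none) ∪ G)
          rw [h4] at h3
          simp only [Fintype.card_fin] at h5
          omega
        have h2' : ((Finset.univ.filter fun i => φ i a ≠ none).card : ℝ) + G.card ≤ n + (G.filter fun i => φ i a ≠ none).card := by
          exact_mod_cast h2
        linarith
      have hup : ∑ a ∈ A, ((G.filter fun i => φ i a ≠ none).card : ℝ) ≤ n * (ℓ * (ℓ / ε) ^ (t - 1)) := by
        have h1 : ∑ a ∈ A, ((G.filter fun i => φ i a ≠ none).card : ℝ) =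
            ∑ i ∈ G, ((A.filter fun a => φ i a ≠ none).card : ℝ) := by
          simp only [Finset.card_filter, Nat.cast_sum]
          rw [Finset.sum_comm]
        rw [h1]
        have hcl : ∀ i ∈ G, ((A.filter fun a => φ i a ≠ none).card : ℝ) ≤ ℓ * (ℓ / ε) ^ (t - 1) := by
          intro i hi
          have hi' : ¬ (U ⊓ patV K (φ i) ≤ constOn U A) := by simpa [G] using hi
          have h2 : (A.filter fun a => φ i a ≠ none) ⊆ Finset.univ.biUnion (fun j : Fin ℓ => A.filter fun a => φ i a = some j) := by
            intro a ha
            simp only [Finset.mem_filter] at ha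
            obtain ⟨j, hj⟩ := Option.ne_none_iff_exists'.1 ha.2
            simp only [Finset.mem_biUnion, Finset.mem_filter, Finset.mem_univ, true_and]
            exact ⟨j, ha.1, hj⟩
          have h3 := (Finset.card_le_card h2).trans Finset.card_biUnion_le
          have h4 : ∀ j : Fin ℓ, ((A.filter fun a => φ i a = some j).card : ℝ) ≤ (ℓ / ε) ^ (t - 1) := by
            intro j
            apply ih (t - 1) (by omega)
            have hlt2 : constOn U A < constOn U (A.filter fun a => φ i a = some j) := by
              rw [SetLike.lt_iff_le_and_exists]
              constructor
              · intro x hx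
                exact ⟨hx.1, fun a ha a' ha' => hx.2 a (Finset.mem_filter.1 ha).1 a' (Finset.mem_filter.1 ha').1⟩
              · rw [SetLike.not_le_iff_exists] at hi'
                obtain ⟨x, hx, hx'⟩ := hi'
                refine ⟨x, ⟨hx.1, fun a ha a' ha' => ?_⟩, hx'⟩
                have e1 := (Finset.mem_filter.1 ha).2
                have e2 := (Finset.mem_filter.1 ha').2
                exact hx.2 a a' (by simp [e1]) (by rw [e1, e2])
            have := Submodule.finrank_lt_finrank_of_lt hlt2
            omega
          calc ((A.filter fun a => φ i a ≠ none).card : ℝ) ≤ ∑ j : Fin ℓ, ((A.filter fun a => φ i a = some j).card : ℝ) := by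
                exact_mod_cast h3
            _ ≤ ∑ j : Fin ℓ, (ℓ / ε) ^ (t - 1) := Finset.sum_le_sum fun j _ => h4 j
            _ = _ := by simp
        calc _ ≤ ∑ i ∈ G, (ℓ * (ℓ / ε) ^ (t - 1) : ℝ) := Finset.sum_le_sum hcl
          _ = G.card * (ℓ * (ℓ / ε) ^ (t - 1)) := by simp
          _ ≤ _ := by
            apply mul_le_mul_of_nonneg_right
            · have := Finset.card_le_univ G
              simp only [Fintype.card_fin] at this
              exact_mod_cast this
            · positivity
      have hfin : (A.card : ℝ) * (ε * n) ≤ (ℓ / ε) ^ t * (ε * n) := by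
        refine (hlow.trans hup).trans (le_of_eq ?_)
        obtain ⟨t', rfl⟩ := Nat.exists_eq_add_of_le' ht
        simp only [Nat.add_sub_cancel, pow_succ]
        field_simp
      exact le_of_mul_le_mul_right hfin (by positivity)
    have := key (finrank K U) Finset.univ (by omega)
    simpa using this

theorem exists_core {K : Type*} [Field K] {b ℓ n : ℕ} (hn : 0 < n) (φ : Fin n → Fin b → Option (Fin ℓ))
    (R ε : ℝ) (hε : 0 < ε) (hℓε : 1 ≤ ℓ / ε) 
    (hagr : ∀ a, (R + ε) * n ≤ ((Finset.univ.filter fun i => φ i a ≠ none).card : ℝ))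
    (hb : (ℓ / ε : ℝ) ^ (ℓ / ε : ℝ) < b) :
    ∃ U' : Submodule K (Fin b → K), (∃ a a', a ≠ a' ∧ ∀ u ∈ U', u a = u a') ∧
      ∀ U, U' ≤ U → R * n * ((finrank K U : ℝ) - finrank K U') ≤
      ∑ i, (((finrank K U : ℝ) - finrank K (U ⊓ patV K (φ i) : Submodule K (Fin b → K)))
        - (finrank K U' - finrank K (U' ⊓ patV K (φ i) : Submodule K (Fin b → K)))) := by
  classical
  let g : Submodule K (Fin b → K) → ℝ := fun U =>
    ∑ i, ((finrank K U : ℝ) - finrank K (U ⊓ patV K (φ i) : Submodule K (Fin b → K)))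
      - R * n * finrank K U
  let h : ℕ × (Fin n → Fin (b + 1)) → ℝ := fun p => ∑ i, ((p.1 : ℝ) - (p.2 i : ℕ)) - R * n * p.1
  have hfr : ∀ U : Submodule K (Fin b → K), finrank K U < b + 1 := by
    intro U
    have := Submodule.finrank_le U
    simp at this
    omega
  have hfin : (Set.range g).Finite := by
    refine Set.Finite.subset (((Finset.range (b + 1) ×ˢ (Finset.univ : Finset (Fin n → Fin (b + 1)))).finite_toSet).image h) ?_
    rintro _ ⟨U, rfl⟩
    refine ⟨(finrank K U, fun i => ⟨finrank K (U ⊓ patV K (φ i) : Submodule K (Fin b → K)), hfr _⟩), ?_, ?_⟩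
    · simp [hfr U]
    · simp [h, g]
  obtain ⟨_, ⟨U', rfl⟩, hmin⟩ := Set.exists_min_image (Set.range g) id hfin ⟨g ⊥, ⊥, rfl⟩
  have hmin' : ∀ U, g U' ≤ g U := fun U => hmin _ ⟨U, rfl⟩
  refine ⟨U', ?_, ?_⟩
  · by_contra hcon
    push Not at hcon
    obtain ⟨h1, h2⟩ := list_bound hn φ R ε hε hℓε hagr U' (by
      intro W hW
      have := hmin' W
      simp only [g, Finset.sum_sub_distrib, Finset.sum_const, Finset.card_univ, Fintype.card_fin, nsmul_eq_mul] at this ⊢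
      linarith) hcon
    have h3 : (finrank K U' : ℝ) ≤ ℓ / ε := by rw [le_div_iff₀ hε]; linarith
    have h4 : (ℓ / ε : ℝ) ^ finrank K U' ≤ (ℓ / ε : ℝ) ^ (ℓ / ε : ℝ) := by
      rw [← Real.rpow_natCast]
      exact Real.rpow_le_rpow_of_exponent_le hℓε h3
    linarith
  · intro U _
    have := hmin' U
    simp only [g, Finset.sum_sub_distrib, Finset.sum_const, Finset.card_univ, Fintype.card_fin, nsmul_eq_mul] at this ⊢
    linarith

/-- evaluation of a vector of polynomials -/
noncomputable def evalVec {K : Type*} [Field K] {s : ℕ} (x : K) : (Fin s → K[X]) →ₗ[K] (Fin s → K) :=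
  LinearMap.pi fun j => (Polynomial.leval x).comp (LinearMap.proj j)

@[simp] lemma evalVec_apply {K : Type*} [Field K] {s : ℕ} (x : K) (f : Fin s → K[X]) (j : Fin s) :
    evalVec x f j = (f j).eval x := rfl

lemma evalVec_smul_poly {K : Type*} [Field K] {s : ℕ} (x : K) (p : K[X]) (f : Fin s → K[X]) :
    evalVec x (p • f) = p.eval x • evalVec x f := by
  ext j; simp

lemma natDegree_det_le {K : Type*} [Field K] {t d : ℕ} (G : Matrix (Fin t) (Fin t) K[X])
    (hG : ∀ i j, (G i j).natDegree ≤ d) : G.det.natDegree ≤ t * d := by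
  rw [Matrix.det_apply]
  refine Polynomial.natDegree_sum_le_of_forall_le _ _ ?_
  intro σ _
  refine (Polynomial.natDegree_smul_le _ _).trans ?_
  refine (Polynomial.natDegree_prod_le _ _).trans ?_
  refine (Finset.sum_le_sum (fun i _ => hG (σ i) i)).trans ?_
  simp

/-- The set of bad evaluation points is contained in the root set of a low degree polynomial. -/
lemma bad_points {K : Type*} [Field K] {s D : ℕ} (W : Submodule K (Fin s → K[X]))
    (hW : ∀ f ∈ W, ∀ j, (f j).degree < (D : WithBot ℕ)) (V : Submodule K (Fin s → K)) (β : K)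
    (hβ : ∀ f ∈ W, evalVec β f ∈ V → f = 0) :
    ∃ p : K[X], p ≠ 0 ∧ p.natDegree ≤ s * D ∧ ∀ x, ∀ f ∈ W, f ≠ 0 → evalVec x f ∈ V → p.eval x = 0 := by
  classical
  let T : W →ₗ[K] ((Fin s → K) ⧸ V) := (V.mkQ.comp (evalVec β)).comp W.subtype
  have hT : Function.Injective T := by
    rw [← LinearMap.ker_eq_bot, LinearMap.ker_eq_bot']
    rintro ⟨f, hf⟩ h
    ext1
    exact hβ f hf (by simpa [T] using h)
  have hfd : FiniteDimensional K W := FiniteDimensional.of_injective T hT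
  have ht : finrank K W ≤ s := by
    have h1 := LinearMap.finrank_le_finrank_of_injective hT
    have h2 := Submodule.finrank_quotient_le V
    simp only [finrank_fintype_fun_eq_card, Fintype.card_fin] at h2
    omega
  let g := finBasis K W
  obtain ⟨S, hS⟩ := LinearMap.exists_leftInverse_of_injective T (LinearMap.ker_eq_bot.2 hT)
  let N : (Fin s → K) →ₗ[K] (Fin (finrank K W) → K) := (g.equivFun.toLinearMap.comp S).comp V.mkQ
  have hNV : ∀ v ∈ V, N v = 0 := by
    intro v hv
    have : V.mkQ v = 0 := by simpa using hv
    simp only [N, LinearMap.comp_apply, this, map_zero]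
  have hNg : ∀ w : W, N (evalVec β w.1) = g.equivFun w := by
    intro w
    have : S (T w) = w := by
      have := LinearMap.congr_fun hS w
      simpa using this
    simp only [N, LinearMap.comp_apply]
    exact congrArg g.equivFun this
  let M : Matrix (Fin (finrank K W)) (Fin (finrank K W)) K[X] :=
    fun k l => ∑ j, C (N (Pi.single j 1) k) * (g l).1 j
  have hMe : ∀ x k l, (M k l).eval x = N (evalVec x (g l).1) k := by
    intro x k l
    rw [show evalVec x (g l).1 = ∑ j, ((g l).1 j).eval x • (Pi.single j 1 : Fin s → K) from ?_]
    · simp only [M, eval_finsetSum, eval_mul, eval_C, map_sum, map_smul, Finset.sum_apply, Pi.smul_apply, smul_eq_mul]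
      exact Finset.sum_congr rfl fun j _ => mul_comm _ _
    · ext j
      simp [Finset.sum_apply, Pi.single_apply]
  have hdet : ∀ x, M.det.eval x = (Matrix.of fun k l => N (evalVec x (g l).1) k).det := by
    intro x
    rw [← Polynomial.coe_evalRingHom, RingHom.map_det]
    congr 1
    ext k l
    simp [hMe]
  refine ⟨M.det, ?_, ?_, ?_⟩
  · intro h0
    have := hdet β
    rw [h0, eval_zero] at this
    have h1 : (Matrix.of fun k l => N (evalVec β (g l).1) k) = 1 := by
      ext k l
      simp only [Matrix.of_apply, hNg, Basis.equivFun_apply, Basis.repr_self, Matrix.one_apply, Finsupp.single_apply, eq_comm]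
    rw [h1, Matrix.det_one] at this
    exact zero_ne_one this
  · refine (natDegree_det_le (d := D) M ?_).trans (Nat.mul_le_mul_right _ ht)
    intro k l
    refine Polynomial.natDegree_sum_le_of_forall_le _ _ ?_
    intro j _
    refine (Polynomial.natDegree_C_mul_le _ _).trans ?_
    by_cases h0 : (g l).1 j = 0
    · simp [h0]
    · exact (Polynomial.natDegree_lt_iff_degree_lt h0 |>.2 (hW _ (g l).2 j)).le
  · intro x f hf hf0 hfV
    rw [hdet]
    rw [← Matrix.exists_mulVec_eq_zero_iff]
    refine ⟨g.equivFun ⟨f, hf⟩, ?_, ?_⟩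
    · intro h
      apply hf0
      have : (⟨f, hf⟩ : W) = 0 := by
        apply g.equivFun.injective; simpa using h
      simpa using congrArg Subtype.val this
    · have h1 : f = ∑ l, g.equivFun ⟨f, hf⟩ l • (g l).1 := by
        have := congrArg Subtype.val (g.sum_equivFun ⟨f, hf⟩)
        rw [Submodule.coe_sum] at this
        exact this.symm
      have h2 : N (evalVec x f) = 0 := hNV _ hfV
      rw [h1] at h2
      rw [← h2]
      ext k
      simp only [Matrix.mulVec, dotProduct, Matrix.of_apply, map_sum, map_smul, Finset.sum_apply, Pi.smul_apply, smul_eq_mul]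
      exact Finset.sum_congr rfl fun j _ => mul_comm _ _

/-- only the zero vector of `M` of degree `< D` satisfies all the constraints at `β` -/
def Rigid {K : Type*} [Field K] {s m : ℕ} (M : Submodule K[X] (Fin s → K[X]))
    (V : Fin m → Submodule K (Fin s → K)) (D : ℕ) (β : Fin m → K) : Prop :=
  ∀ f ∈ M, (∀ j, (f j).degree < (D : WithBot ℕ)) → (∀ i, evalVec (β i) f ∈ V i) → f = 0

/-- submodule cut out by one more constraint -/
noncomputable def cut {K : Type*} [Field K] {s : ℕ} (M : Submodule K[X] (Fin s → K[X]))
    (V : Submodule K (Fin s → K)) (x : K) : Submodule K[X] (Fin s → K[X]) where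
  carrier := {f | f ∈ M ∧ evalVec x f ∈ V}
  add_mem' := by
    rintro f g ⟨hf, hf'⟩ ⟨hg, hg'⟩
    exact ⟨M.add_mem hf hg, by rw [map_add]; exact V.add_mem hf' hg'⟩
  zero_mem' := ⟨M.zero_mem, by rw [map_zero]; exact V.zero_mem⟩
  smul_mem' := by
    rintro p f ⟨hf, hf'⟩
    exact ⟨M.smul_mem p hf, by rw [evalVec_smul_poly]; exact V.smul_mem _ hf'⟩

lemma rigid_cons_iff {K : Type*} [Field K] {s m : ℕ} (M : Submodule K[X] (Fin s → K[X]))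
    (V : Fin (m + 1) → Submodule K (Fin s → K)) (D : ℕ) (x : K) (β : Fin m → K) :
    Rigid M V D (Fin.cons x β) ↔ Rigid (cut M (V 0) x) (fun i => V i.succ) D β := by
  unfold Rigid
  constructor
  · intro h f hf hd hc
    refine h f hf.1 hd ?_
    intro i
    refine Fin.cases ?_ (fun i => ?_) i
    · simpa using hf.2
    · simpa using hc i
  · intro h f hf hd hc
    refine h f ⟨hf, by simpa using hc 0⟩ hd (fun i => by simpa using hc i.succ)

lemma rigid_drop {K : Type*} [Field K] {s m : ℕ} (M : Submodule K[X] (Fin s → K[X]))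
    (V : Fin (m + 1) → Submodule K (Fin s → K)) (D : ℕ) (β : Fin (m + 1) → K) (x : K)
    (h : Rigid M V (D + 1) β) : Rigid (cut M (V 0) x) (fun i => V i.succ) D (Fin.tail β) := by
  intro f hf hd hc
  have h1 := h ((X - C (β 0)) • f) (M.smul_mem _ hf.1) ?_ ?_
  · ext1 j
    have := congrFun h1 j
    simp only [Pi.smul_apply, smul_eq_mul, Pi.zero_apply, mul_eq_zero] at this
    exact this.resolve_left (Polynomial.X_sub_C_ne_zero _)
  · intro j
    simp only [Pi.smul_apply, smul_eq_mul]
    by_cases h0 : f j = 0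
    · rw [h0, mul_zero, Polynomial.degree_zero]; exact WithBot.bot_lt_coe _
    · have h3 := (Polynomial.natDegree_lt_iff_degree_lt h0).2 (hd j)
      rw [← Polynomial.natDegree_lt_iff_degree_lt (mul_ne_zero (Polynomial.X_sub_C_ne_zero _) h0),
        Polynomial.natDegree_mul (Polynomial.X_sub_C_ne_zero _) h0, Polynomial.natDegree_X_sub_C]
      omega
  · intro i
    rw [evalVec_smul_poly]
    refine Fin.cases ?_ (fun i => ?_) i
    · simp
    · exact (V i.succ).smul_mem _ (hc i)

theorem count_bad {K F : Type*} [Field K] [Field F] [Fintype F] [Algebra F K] {s : ℕ} (k E : ℕ) :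
    ∀ (m : ℕ) (M : Submodule K[X] (Fin s → K[X])) (V : Fin m → Submodule K (Fin s → K)) (e : ℕ),
      e ≤ E → (∃ β, Rigid M V (k + e) β) →
      (({α : Fin m → F | ¬ Rigid M V k (fun i => algebraMap F K (α i))}).ncard : ℝ) *
        (Fintype.card F : ℝ) ^ e ≤
        (m.choose e : ℝ) * (s * (k + E) : ℝ) ^ e * (Fintype.card F : ℝ) ^ m := by
  classical
  have hmono : ∀ {m : ℕ} (M : Submodule K[X] (Fin s → K[X])) (V : Fin m → Submodule K (Fin s → K)) (D D' : ℕ) (β : Fin m → K),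
    D ≤ D' → Rigid M V D' β → Rigid M V D β := by
    intro m M V D D' β hD h f hf hd hc
    exact h f hf (fun j => (hd j).trans_le (by exact_mod_cast hD)) hc
  intro m
  induction m with
  | zero =>
    intro M V e he hG
    rcases e with _ | e
    · simp only [pow_zero, mul_one, Nat.choose_self, Nat.cast_one, one_mul]
      have := Set.ncard_le_card {α : Fin 0 → F | ¬ Rigid M V k (fun i => algebraMap F K (α i))}
      simp only [Nat.card_eq_fintype_card, Fintype.card_pi, Finset.univ_eq_empty, Finset.prod_empty] at this
      exact_mod_cast this
    · obtain ⟨β, hβ⟩ := hG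
      have : {α : Fin 0 → F | ¬ Rigid M V k (fun i => algebraMap F K (α i))} = ∅ := by
        ext α
        simp only [Set.mem_ofPred_eq, Set.mem_empty_iff_false, iff_false, not_not]
        have : (fun i => algebraMap F K (α i)) = β := Subsingleton.elim _ _
        rw [this]
        exact hmono M V _ _ _ (by omega) hβ
      rw [this]
      simp
  | succ m ih =>
    intro M V e he hG
    rcases e with _ | e
    · simp only [pow_zero, mul_one, Nat.choose_zero_right, Nat.cast_one, one_mul]
      have := Set.ncard_le_card {α : Fin (m+1) → F | ¬ Rigid M V k (fun i => algebraMap F K (α i))}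
      simp only [Nat.card_eq_fintype_card, Fintype.card_pi, Finset.prod_const, Finset.card_univ, Fintype.card_fin] at this
      exact_mod_cast this
    · obtain ⟨β, hβ⟩ := hG
      set q : ℝ := (Fintype.card F : ℝ) with hq
      set Δ : ℝ := (s * (k + E) : ℝ) with hΔ
      let Nb : F → ℝ := fun a => (({α : Fin m → F | ¬ Rigid (cut M (V 0) (algebraMap F K a)) (fun i => V i.succ) k (fun i => algebraMap F K (α i))}).ncard : ℝ)
      have hsum : (({α : Fin (m+1) → F | ¬ Rigid M V k (fun i => algebraMap F K (α i))}).ncard : ℝ) = ∑ a, Nb a := by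
        have e1 : ∀ (P : (Fin (m+1) → F) → Prop), ({α | P α}).ncard = ∑ a : F, ({α : Fin m → F | P (Fin.cons a α)}).ncard := by
          intro P
          have e2 : ∀ {m} (P : (Fin m → F) → Prop), ({α | P α}).ncard = (Finset.univ.filter P).card := by
            intro m P
            rw [← Set.ncard_coe_finset]; congr 1; ext; simp
          simp only [e2, Finset.card_filter]
          rw [← (Fin.consEquiv (fun _ => F)).sum_comp, Fintype.sum_prod_type]
          rfl
        rw [e1, Nat.cast_sum]
        refine Finset.sum_congr rfl fun a _ => ?_
        simp only [Nb]
        congr 2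
        ext α
        simp only [Set.mem_ofPred_eq]
        rw [← rigid_cons_iff]
        have : (fun i => algebraMap F K ((Fin.cons a α : Fin (m+1) → F) i)) = (Fin.cons (algebraMap F K a) (fun i => algebraMap F K (α i)) : Fin (m+1) → K) := by
          ext i
          refine Fin.cases ?_ (fun i => ?_) i <;> simp
        rw [this]
      -- the bad first coordinates
      let B : Finset F := Finset.univ.filter fun a =>
        ¬ ∃ β', Rigid (cut M (V 0) (algebraMap F K a)) (fun i => V i.succ) (k + (e + 1)) β'
      have hB : (B.card : ℝ) ≤ Δ := by
        let W : Submodule K (Fin s → K[X]) :=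
          { carrier := {f | f ∈ M ∧ (∀ j, (f j).degree < ((k + (e+1) : ℕ) : WithBot ℕ)) ∧ ∀ i : Fin m, evalVec (β i.succ) f ∈ V i.succ}
            add_mem' := by
              rintro f g ⟨h1, h2, h3⟩ ⟨g1, g2, g3⟩
              exact ⟨M.add_mem h1 g1, fun j => (Polynomial.degree_add_le _ _).trans_lt (max_lt (h2 j) (g2 j)),
                fun i => by rw [map_add]; exact (V i.succ).add_mem (h3 i) (g3 i)⟩
            zero_mem' := ⟨M.zero_mem, fun j => by simp [WithBot.bot_lt_coe], fun i => by rw [map_zero]; exact (V i.succ).zero_mem⟩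
            smul_mem' := by
              rintro c f ⟨h1, h2, h3⟩
              refine ⟨?_, fun j => (Polynomial.degree_smul_le _ _).trans_lt (h2 j),
                fun i => by rw [map_smul]; exact (V i.succ).smul_mem _ (h3 i)⟩
              have : c • f = (C c : K[X]) • f := by
                ext1 j; simp [Polynomial.smul_eq_C_mul]
              rw [this]
              exact M.smul_mem _ h1 }
        obtain ⟨p, hp0, hpd, hp⟩ := bad_points (D := k + (e+1)) W (fun f hf => hf.2.1) (V 0) (β 0) (by
          rintro f ⟨h1, h2, h3⟩ h4
          exact hβ f h1 h2 (fun i => Fin.cases h4 h3 i))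
        have hsub : B.image (algebraMap F K) ⊆ p.roots.toFinset := by
          intro y hy
          obtain ⟨a, ha, rfl⟩ := Finset.mem_image.1 hy
          rw [Multiset.mem_toFinset, Polynomial.mem_roots hp0]
          have ha' := (Finset.mem_filter.1 ha).2
          push Not at ha'
          have := ha' (Fin.tail β)
          unfold Rigid at this
          push Not at this
          obtain ⟨f, hf, hd, hc, hf0⟩ := this
          exact hp _ f ⟨hf.1, hd, hc⟩ hf0 hf.2
        have h1 := Finset.card_le_card hsub
        rw [Finset.card_image_of_injective _ (algebraMap F K).injective] at h1
        have h2 := h1.trans ((Multiset.toFinset_card_le _).trans ((Polynomial.card_roots' p).trans hpd))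
        have h3 : s * (k + (e + 1)) ≤ s * (k + E) := Nat.mul_le_mul_left _ (by omega)
        have h4 := h2.trans h3
        rw [hΔ]
        exact_mod_cast h4
      have hq0 : 0 ≤ q := by positivity
      have hΔ0 : 0 ≤ Δ := by positivity
      have hbad : ∀ a ∈ B, Nb a * q ^ (e + 1) ≤ q * ((m.choose e : ℝ) * Δ ^ e * q ^ m) := by
        intro a _
        have := ih (cut M (V 0) (algebraMap F K a)) (fun i => V i.succ) e (by omega)
          ⟨Fin.tail β, rigid_drop M V (k + e) β _ hβ⟩
        calc _ = q * (Nb a * q ^ e) := by ring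
          _ ≤ _ := mul_le_mul_of_nonneg_left this hq0
      have hgood : ∀ a ∈ Finset.univ.filter (fun a => a ∉ B), Nb a * q ^ (e + 1) ≤ ((m.choose (e+1) : ℝ) * Δ ^ (e+1) * q ^ m) := by
        intro a ha
        have ha' : ∃ β', Rigid (cut M (V 0) (algebraMap F K a)) (fun i => V i.succ) (k + (e + 1)) β' := by
          by_contra h
          exact (Finset.mem_filter.1 ha).2 (Finset.mem_filter.2 ⟨Finset.mem_univ _, h⟩)
        exact ih (cut M (V 0) (algebraMap F K a)) (fun i => V i.succ) (e+1) he ha'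
      rw [hsum, Finset.sum_mul]
      rw [← Finset.sum_filter_add_sum_filter_not Finset.univ (fun a => a ∈ B)]
      have hBB : Finset.univ.filter (fun a => a ∈ B) = B := by ext; simp
      rw [hBB]
      have s1 := Finset.sum_le_sum hbad
      have s2 := Finset.sum_le_sum hgood
      rw [Finset.sum_const, nsmul_eq_mul] at s1 s2
      have c2 : ((Finset.univ.filter (fun a => a ∉ B)).card : ℝ) ≤ q := by
        rw [hq]; exact_mod_cast Finset.card_le_univ _
      have s1' : (B.card : ℝ) * (q * ((m.choose e : ℝ) * Δ ^ e * q ^ m)) ≤ Δ * (q * ((m.choose e : ℝ) * Δ ^ e * q ^ m)) :=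
        mul_le_mul_of_nonneg_right hB (by positivity)
      have s2' := mul_le_mul_of_nonneg_right c2 (show 0 ≤ ((m.choose (e+1) : ℝ) * Δ ^ (e+1) * q ^ m) by positivity)
      have hch : ((m + 1).choose (e + 1) : ℝ) = m.choose e + m.choose (e + 1) := by
        exact_mod_cast Nat.choose_succ_succ m e
      rw [hch]
      calc _ ≤ Δ * (q * ((m.choose e : ℝ) * Δ ^ e * q ^ m)) + q * ((m.choose (e+1) : ℝ) * Δ ^ (e+1) * q ^ m) := by
            exact add_le_add (s1.trans s1') (s2.trans s2')
        _ = _ := by ring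

lemma exists_matrix_of_submodule {K : Type*} [Field K] {s : ℕ} (V : Submodule K (Fin s → K)) :
    ∃ A : Matrix (Fin s) (Fin s) K, ∀ v, v ∈ V ↔ A.mulVec v = 0 := by
  obtain ⟨W, hW⟩ := Submodule.exists_isCompl V
  let T : (Fin s → K) →ₗ[K] (Fin s → K) := W.subtype.comp (Submodule.projectionOnto W V hW.symm)
  refine ⟨LinearMap.toMatrix' T, fun v => ?_⟩
  have h1 : (LinearMap.toMatrix' T).mulVec v = T v := by
    rw [← Matrix.toLin'_apply, Matrix.toLin'_toMatrix']
  rw [h1]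
  simp only [T, LinearMap.comp_apply, Submodule.subtype_apply, Submodule.coe_eq_zero]
  rw [Submodule.projectionOnto_apply_eq_zero_iff]

lemma det_dvd {K : Type*} [Field K] {r : ℕ} (H : Matrix (Fin r) (Fin r) K[X]) (β : K)
    (Y : Submodule K (Fin r → K)) (hY : ∀ l, evalVec β (H l) ∈ Y) :
    (X - C β) ^ (r - finrank K Y) ∣ H.det := by
  classical
  obtain ⟨Z, hZ⟩ := Submodule.exists_isCompl Y
  have hdim : finrank K Z = r - finrank K Y := by
    have := Submodule.finrank_add_eq_of_isCompl hZ
    simp at this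
    omega
  let bas : Basis (Fin (finrank K Z) ⊕ Fin (finrank K Y)) K (Fin r → K) :=
    ((finBasis K Z).prod (finBasis K Y)).map (Submodule.prodEquivOfIsCompl Z Y hZ.symm)
  have hrep : ∀ y ∈ Y, ∀ c, bas.repr y (Sum.inl c) = 0 := by
    intro y hy c
    have : (Submodule.prodEquivOfIsCompl Z Y hZ.symm).symm y = (0, ⟨y, hy⟩) := by
      rw [LinearEquiv.symm_apply_eq]
      simp
    simp [bas, this]
  let eq : Fin r ≃ (Fin (finrank K Z) ⊕ Fin (finrank K Y)) :=
    (Fintype.equivOfCardEq (by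
      have := Submodule.finrank_add_eq_of_isCompl hZ
      simp at this ⊢
      omega))
  let b2 : Basis (Fin r) K (Fin r → K) := bas.reindex eq.symm
  let N : Matrix (Fin r) (Fin r) K := fun t c => b2.repr (Pi.single t 1) c
  have hN : IsUnit N.det := by
    have : N = (b2.toMatrix (Pi.basisFun K (Fin r))).transpose := by
      ext t c
      simp [N, Basis.toMatrix_apply]
    rw [this, Matrix.det_transpose]
    have := b2.toMatrix_mul_toMatrix_flip (Pi.basisFun K (Fin r))
    rw [← Matrix.isUnit_iff_isUnit_det]
    exact IsUnit.of_mul_eq_one _ this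
  -- number of divisible columns
  let H2 := H * N.map C
  have hH2 : H2.det = H.det * C N.det := by
    simp only [H2, Matrix.det_mul]
    congr 1
    exact (RingHom.map_det C N).symm
  have hcol : ∀ l c, (eq c).isLeft = true → (X - C β) ∣ H2 l c := by
    intro l c hc
    rw [Polynomial.dvd_iff_isRoot, Polynomial.IsRoot]
    have h1 : (H2 l c).eval β = b2.repr (evalVec β (H l)) c := by
      rw [show evalVec β (H l) = ∑ t, ((H l t).eval β) • (Pi.single t 1 : Fin r → K) from ?_]
      · simp only [H2, Matrix.mul_apply, eval_finsetSum, eval_mul, Matrix.map_apply, eval_C, map_sum, map_smul, Finsupp.coe_finsetSum, Finset.sum_apply, Finsupp.smul_apply, smul_eq_mul]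
        rfl
      · ext j
        simp [Finset.sum_apply, Pi.single_apply]
    rw [h1]
    simp only [b2, Basis.repr_reindex, Finsupp.mapDomain_equiv_apply, Equiv.symm_symm]
    obtain ⟨c', hc'⟩ := Sum.isLeft_iff.1 hc
    rw [hc']
    exact hrep _ (hY l) c'
  choose g hg using hcol
  let G : Matrix (Fin r) (Fin r) K[X] := fun l c => if h : (eq c).isLeft = true then g l c h else H2 l c
  have hdet : H2.det = (∏ c, (if (eq c).isLeft = true then (X - C β) else 1)) * G.det := by
    rw [← Matrix.det_mul_row]
    congr 1
    ext1 l c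
    simp only [Matrix.of_apply, G]
    split_ifs with h
    · exact hg l c h
    · simp
  have hprod : (∏ c, (if (eq c).isLeft = true then (X - C β) else 1)) = (X - C β) ^ (r - finrank K Y) := by
    rw [← eq.symm.prod_comp]
    simp [hdim]
  rw [hprod, hH2] at hdet
  have : (X - C β) ^ (r - finrank K Y) ∣ H.det * C N.det := ⟨_, hdet⟩
  refine (IsUnit.dvd_mul_right ?_).1 this
  exact hN.map C

lemma det_count {K : Type*} [Field K] {r m n : ℕ} (H : Matrix (Fin r) (Fin r) K[X])
    (hdet : H.det ≠ 0) (hdeg : ∀ i j, (H i j).natDegree ≤ m) (β : Fin n → K)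
    (hβ : Function.Injective β) (Y : Fin n → Submodule K (Fin r → K))
    (hY : ∀ i l, evalVec (β i) (H l) ∈ Y i) :
    ∑ i, (r - finrank K (Y i)) ≤ r * m := by
  have h1 : ∏ i, (X - C (β i)) ^ (r - finrank K (Y i)) ∣ H.det := by
    apply Finset.prod_dvd_of_coprime
    · intro i _ j _ hij
      apply IsCoprime.pow
      exact Polynomial.isCoprime_X_sub_C_of_isUnit_sub (by
        rw [isUnit_iff_ne_zero, sub_ne_zero]; exact fun h => hij (hβ h))
    · intro i _
      exact det_dvd H (β i) (Y i) (hY i)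
  have h2 := Polynomial.natDegree_le_of_dvd h1 hdet
  rw [Polynomial.natDegree_prod _ _ (fun i _ => pow_ne_zero _ (Polynomial.X_sub_C_ne_zero _))] at h2
  simp only [Polynomial.natDegree_pow, Polynomial.natDegree_X_sub_C, mul_one] at h2
  exact h2.trans (natDegree_det_le H hdeg)

lemma exists_generic_kernel {K : Type*} [Field K] [Infinite K] {σ ι κ : Type*} [Fintype ι] [Fintype κ]
    [DecidableEq ι] [DecidableEq κ]
    (T : Matrix ι κ (MvPolynomial σ K))
    (h : ∀ β : σ → K, ∃ v : κ → K, v ≠ 0 ∧ (T.map (MvPolynomial.eval β)).mulVec v = 0) :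
    ∃ v : κ → MvPolynomial σ K, v ≠ 0 ∧ T.mulVec v = 0 := by
  classical
  by_contra hcon
  push Not at hcon
  let Q := FractionRing (MvPolynomial σ K)
  let TQ : Matrix ι κ Q := T.map (algebraMap (MvPolynomial σ K) Q)
  have hinj : LinearMap.ker (Matrix.mulVecLin TQ) = ⊥ := by
    rw [LinearMap.ker_eq_bot']
    intro u hu
    obtain ⟨d, hd⟩ := IsLocalization.exist_integer_multiples_of_finite
      (nonZeroDivisors (MvPolynomial σ K)) u
    choose w hw using hd
    have hd0 : algebraMap (MvPolynomial σ K) Q d ≠ 0 := by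
      simpa using nonZeroDivisors.ne_zero d.2
    have hTw : T.mulVec w = 0 := by
      ext1 i
      apply IsFractionRing.injective (MvPolynomial σ K) Q
      have h1 : ∑ j, TQ i j * u j = 0 := congrFun hu i
      simp only [Matrix.mulVec, dotProduct, map_sum, map_mul, Pi.zero_apply, map_zero]
      have : ∀ j, algebraMap (MvPolynomial σ K) Q (T i j) * algebraMap (MvPolynomial σ K) Q (w j)
          = algebraMap (MvPolynomial σ K) Q d * (TQ i j * u j) := by
        intro j
        rw [hw j, Algebra.smul_def]
        simp only [TQ, Matrix.map_apply]
        ring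
      rw [Finset.sum_congr rfl (fun j _ => this j), ← Finset.mul_sum, h1, mul_zero]
    have hw0 : w = 0 := by
      by_contra hne
      exact hcon w hne hTw
    ext1 j
    have := hw j
    rw [hw0, Algebra.smul_def] at this
    simp only [Pi.zero_apply, map_zero] at this
    simpa [hd0] using this.symm
  obtain ⟨g, hg⟩ := LinearMap.exists_leftInverse_of_injective _ hinj
  let N : Matrix κ ι Q := LinearMap.toMatrix' g
  have hNT : N * TQ = 1 := by
    have : Matrix.toLin' (N * TQ) = LinearMap.id := by
      rw [Matrix.toLin'_mul]
      simp only [N, Matrix.toLin'_toMatrix']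
      exact hg
    rw [← LinearMap.toMatrix'_toLin' (N * TQ), this, LinearMap.toMatrix'_id]
  obtain ⟨d, hd⟩ := IsLocalization.exist_integer_multiples_of_finite
      (nonZeroDivisors (MvPolynomial σ K)) (fun p : κ × ι => N p.1 p.2)
  choose w hw using hd
  have hd0 : (d : MvPolynomial σ K) ≠ 0 := nonZeroDivisors.ne_zero d.2
  let N2 : Matrix κ ι (MvPolynomial σ K) := Matrix.of fun a b => w (a, b)
  have hN2w : ∀ a b, algebraMap (MvPolynomial σ K) Q (N2 a b) = algebraMap (MvPolynomial σ K) Q d * N a b := by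
    intro a b
    rw [← Algebra.smul_def]
    exact hw (a, b)
  have hN2 : N2 * T = (d : MvPolynomial σ K) • (1 : Matrix κ κ (MvPolynomial σ K)) := by
    ext1 a b
    apply IsFractionRing.injective (MvPolynomial σ K) Q
    have h1 := congrFun (congrFun hNT a) b
    rw [Matrix.mul_apply] at h1 ⊢
    rw [Matrix.smul_apply, smul_eq_mul, map_mul, map_sum]
    simp only [map_mul, hN2w]
    simp only [mul_assoc, ← Finset.mul_sum]
    have h2 : (algebraMap (MvPolynomial σ K) Q) ((1 : Matrix κ κ (MvPolynomial σ K)) a b) = (1 : Matrix κ κ Q) a b := by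
      simp only [Matrix.one_apply]; split_ifs <;> simp
    rw [h2, ← h1]
    rfl
  obtain ⟨β, hβ⟩ : ∃ β : σ → K, MvPolynomial.eval β (d : MvPolynomial σ K) ≠ 0 := by
    by_contra hne
    push Not at hne
    exact hd0 (MvPolynomial.funext (fun x => by simpa using hne x))
  obtain ⟨v, hv0, hv⟩ := h β
  apply hv0
  have h3 : (N2 * T).map (MvPolynomial.eval β) = (MvPolynomial.eval β (d : MvPolynomial σ K)) • (1 : Matrix κ κ K) := by
    rw [hN2]
    ext1 a b
    simp only [Matrix.map_apply, Matrix.smul_apply, smul_eq_mul, map_mul, Matrix.one_apply]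
    split_ifs <;> simp
  rw [Matrix.map_mul] at h3
  have h4 : (MvPolynomial.eval β (d : MvPolynomial σ K)) • v = 0 := by
    have : ((MvPolynomial.eval β (d : MvPolynomial σ K)) • (1 : Matrix κ κ K)).mulVec v = 0 := by
      rw [← h3, ← Matrix.mulVec_mulVec, hv, Matrix.mulVec_zero]
    simpa [Matrix.smul_mulVec] using this
  exact (smul_eq_zero.1 h4).resolve_left hβ

section framework

variable {K : Type*} [Field K] {n s : ℕ}

/-- substitute the distinguished variable by the `i`-th one -/
noncomputable def ev (i : Fin n) :
    MvPolynomial (Option (Fin n)) K →ₐ[K] MvPolynomial (Option (Fin n)) K :=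
  MvPolynomial.rename (fun v => some (v.getD i))

/-- the `i`-th constraint -/
def Cons (A : Fin n → Matrix (Fin s) (Fin s) K) (i : Fin n)
    (f : Fin s → MvPolynomial (Option (Fin n)) K) : Prop :=
  ∀ r, ∑ j, MvPolynomial.C (A i r j) * ev i (f j) = 0

/-- solutions of bounded degree in the distinguished variable -/
def Wm (A : Fin n → Matrix (Fin s) (Fin s) K) (m : ℕ) :
    Set (Fin s → MvPolynomial (Option (Fin n)) K) :=
  {f | (∀ j, (f j).degreeOf none ≤ m) ∧ ∀ i, Cons A i f}

/-- embedding into the fraction field -/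
noncomputable def emb (f : Fin s → MvPolynomial (Option (Fin n)) K) :
    Fin s → FractionRing (MvPolynomial (Option (Fin n)) K) :=
  fun j => algebraMap _ _ (f j)

/-- span of solutions -/
noncomputable def Um (A : Fin n → Matrix (Fin s) (Fin s) K) (m : ℕ) :
    Submodule (FractionRing (MvPolynomial (Option (Fin n)) K))
      (Fin s → FractionRing (MvPolynomial (Option (Fin n)) K)) :=
  Submodule.span _ (emb '' Wm A m)

/-- weight of a monomial -/
noncomputable def wt (w : Option (Fin n) → K) (μ : Option (Fin n) →₀ ℕ) : K :=
  μ.prod fun v e => w v ^ e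

/-- scaling of variables -/
noncomputable def tau (w : Option (Fin n) → K) :
    MvPolynomial (Option (Fin n)) K →ₐ[K] MvPolynomial (Option (Fin n)) K :=
  MvPolynomial.aeval fun v => MvPolynomial.C (w v) * MvPolynomial.X v

lemma coeff_tau (w : Option (Fin n) → K) (f : MvPolynomial (Option (Fin n)) K)
    (μ : Option (Fin n) →₀ ℕ) : (tau w f).coeff μ = wt w μ * f.coeff μ := by
  classical
  induction f using MvPolynomial.induction_on' with
  | monomial ν a =>
    have : tau w (MvPolynomial.monomial ν a) = MvPolynomial.monomial ν (wt w ν * a) := by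
      rw [tau, MvPolynomial.aeval_monomial]
      simp only [mul_pow, Finsupp.prod_mul, MvPolynomial.algebraMap_eq]
      rw [MvPolynomial.monomial_eq, MvPolynomial.C_mul]
      have : (ν.prod fun a b => (MvPolynomial.C (w a) : MvPolynomial (Option (Fin n)) K) ^ b)
          = MvPolynomial.C (wt w ν) := by
        simp [wt, Finsupp.prod, map_prod]
      rw [this]; ring
    rw [this, MvPolynomial.coeff_monomial, MvPolynomial.coeff_monomial]
    split_ifs with h
    · rw [h]
    · simp
  | add p q hp hq => rw [map_add, MvPolynomial.coeff_add, hp, hq, MvPolynomial.coeff_add, mul_add]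

lemma wt_ne_zero (w : Option (Fin n) → K) (hw : ∀ v, w v ≠ 0) (μ : Option (Fin n) →₀ ℕ) :
    wt w μ ≠ 0 := by
  rw [wt, Finsupp.prod, Finset.prod_ne_zero_iff]
  exact fun v _ => pow_ne_zero _ (hw v)

lemma tau_injective (w : Option (Fin n) → K) (hw : ∀ v, w v ≠ 0) :
    Function.Injective (tau w) := by
  rw [injective_iff_map_eq_zero]
  intro f hf
  ext μ
  have := coeff_tau w f μ
  rw [hf] at this
  simpa [wt_ne_zero w hw μ] using this.symm

lemma degreeOf_le_of_coeff {f : MvPolynomial (Option (Fin n)) K} {m : ℕ}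
    (h : ∀ μ, f.coeff μ ≠ 0 → μ none ≤ m) : f.degreeOf none ≤ m := by
  rw [MvPolynomial.degreeOf_le_iff]
  intro μ hμ
  exact h μ (MvPolynomial.mem_support_iff.1 hμ)

lemma le_of_degreeOf {f : MvPolynomial (Option (Fin n)) K} {m : ℕ}
    (h : f.degreeOf none ≤ m) (μ) (hμ : f.coeff μ ≠ 0) : μ none ≤ m := by
  rw [MvPolynomial.degreeOf_le_iff] at h
  exact h μ (MvPolynomial.mem_support_iff.2 hμ)

lemma degreeOf_tau_le (w : Option (Fin n) → K) {f : MvPolynomial (Option (Fin n)) K} {m : ℕ}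
    (h : f.degreeOf none ≤ m) : (tau w f).degreeOf none ≤ m := by
  apply degreeOf_le_of_coeff
  intro μ hμ
  rw [coeff_tau] at hμ
  exact le_of_degreeOf h μ (right_ne_zero_of_mul hμ)

lemma ev_tau (w : Option (Fin n) → K) (j : Fin n) (h : w (some j) = w none)
    (f : MvPolynomial (Option (Fin n)) K) : ev j (tau w f) = tau w (ev j f) := by
  have : (ev j).comp (tau w) = (tau w).comp (ev j) := by
    apply MvPolynomial.algHom_ext
    intro v
    simp only [AlgHom.comp_apply, tau, ev, MvPolynomial.aeval_X, map_mul, MvPolynomial.rename_C,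
      MvPolynomial.rename_X]
    cases v <;> simp [h]
  exact DFunLike.congr_fun this f

lemma cons_tau (A : Fin n → Matrix (Fin s) (Fin s) K) (w : Option (Fin n) → K) (j : Fin n)
    (h : w (some j) = w none) (f : Fin s → MvPolynomial (Option (Fin n)) K) (hf : Cons A j f) :
    Cons A j (fun c => tau w (f c)) := by
  intro r
  have := congrArg (tau w) (hf r)
  rw [map_sum, map_zero] at this
  rw [← this]
  refine Finset.sum_congr rfl fun c _ => ?_
  rw [map_mul, ev_tau w j h]
  congr 1
  simp [tau]

lemma Wm_mono (A : Fin n → Matrix (Fin s) (Fin s) K) {m m' : ℕ} (h : m ≤ m') :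
    Wm A m ⊆ Wm A m' := fun _ hf => ⟨fun j => (hf.1 j).trans h, hf.2⟩

lemma Um_mono (A : Fin n → Matrix (Fin s) (Fin s) K) {m m' : ℕ} (h : m ≤ m') :
    Um A m ≤ Um A m' := Submodule.span_mono (Set.image_mono (Wm_mono A h))

lemma emb_smul (p : MvPolynomial (Option (Fin n)) K)
    (f : Fin s → MvPolynomial (Option (Fin n)) K) :
    emb (fun j => p * f j) = (algebraMap _ (FractionRing (MvPolynomial (Option (Fin n)) K)) p) • emb f := by
  ext j; simp [emb]

lemma emb_div_mem (A : Fin n → Matrix (Fin s) (Fin s) K) (m : ℕ)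
    (p : MvPolynomial (Option (Fin n)) K) (hp : p ≠ 0)
    (f : Fin s → MvPolynomial (Option (Fin n)) K) (h : emb (fun j => p * f j) ∈ Um A m) :
    emb f ∈ Um A m := by
  rw [emb_smul] at h
  have hp' : (algebraMap _ (FractionRing (MvPolynomial (Option (Fin n)) K)) p) ≠ 0 := by
    simpa using hp
  have := (Um A m).smul_mem (algebraMap _ (FractionRing (MvPolynomial (Option (Fin n)) K)) p)⁻¹ h
  rwa [smul_smul, inv_mul_cancel₀ hp', one_smul] at this

/-- one missing constraint is harmless -/
lemma mem_Um_of_missing (A : Fin n → Matrix (Fin s) (Fin s) K) (m : ℕ) (hm : Um A (m+1) = Um A m)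
    (i : Fin n) (f : Fin s → MvPolynomial (Option (Fin n)) K)
    (hdeg : ∀ j, (f j).degreeOf none ≤ m) (hc : ∀ j, j ≠ i → Cons A j f) : emb f ∈ Um A m := by
  have hp : (MvPolynomial.X none - MvPolynomial.X (some i) : MvPolynomial (Option (Fin n)) K) ≠ 0 := by
    rw [sub_ne_zero]
    intro h
    have := MvPolynomial.X_injective h
    simp at this
  apply emb_div_mem A m _ hp
  rw [← hm]
  apply Submodule.subset_span
  refine ⟨_, ⟨fun j => ?_, fun j => ?_⟩, rfl⟩
  · refine (MvPolynomial.degreeOf_mul_le _ _ _).trans ?_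
    have : (MvPolynomial.X none - MvPolynomial.X (some i) : MvPolynomial (Option (Fin n)) K).degreeOf none ≤ 1 := by
      refine (MvPolynomial.degreeOf_sub_le _ _ _).trans ?_
      rw [MvPolynomial.degreeOf_X, MvPolynomial.degreeOf_X]
      simp
    have := hdeg j
    omega
  · intro r
    have h1 : ∀ c, MvPolynomial.C (A j r c) * ev j ((MvPolynomial.X none - MvPolynomial.X (some i)) * f c)
      = ev j (MvPolynomial.X none - MvPolynomial.X (some i)) * (MvPolynomial.C (A j r c) * ev j (f c)) := by
      intro c; rw [map_mul]; ring
    rw [Finset.sum_congr rfl (fun c _ => h1 c), ← Finset.mul_sum]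
    by_cases hj : j = i
    · subst hj
      have : ev j (MvPolynomial.X none - MvPolynomial.X (some j) : MvPolynomial (Option (Fin n)) K) = 0 := by
        simp [ev]
      rw [this, zero_mul]
    · rw [hc j hj r, mul_zero]

lemma tau_mem_Um (A : Fin n → Matrix (Fin s) (Fin s) K) (m : ℕ) (hm : Um A (m+1) = Um A m)
    (w : Option (Fin n) → K) (hw : ∀ v, w v ≠ 0) (i : Option (Fin n))
    (hi : ∀ j, some j ≠ i → w (some j) = w none)
    (f : Fin s → MvPolynomial (Option (Fin n)) K) (hf : emb f ∈ Um A m) :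
    emb (fun j => tau w (f j)) ∈ Um A m := by
  have hinj : Function.Injective (tau w).toRingHom := tau_injective w hw
  let θ : FractionRing (MvPolynomial (Option (Fin n)) K) →+* FractionRing (MvPolynomial (Option (Fin n)) K) :=
    IsFractionRing.map hinj
  have hθ : ∀ p, θ (algebraMap _ _ p) = algebraMap _ _ (tau w p) := fun p => by
    simp only [θ, IsFractionRing.map]
    exact IsLocalization.map_eq _ p
  have key : ∀ u ∈ Um A m, (fun j => θ (u j)) ∈ Um A m := by
    intro u hu
    induction hu using Submodule.span_induction with
    | mem x hx =>
      obtain ⟨g, hg, rfl⟩ := hx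
      have h1 : (fun j => θ (emb g j)) = emb (fun j => tau w (g j)) := by
        ext1 j; exact hθ _
      rw [h1]
      cases i with
      | none =>
        apply Submodule.subset_span
        refine ⟨_, ⟨fun j => degreeOf_tau_le w (hg.1 j), fun j => ?_⟩, rfl⟩
        exact cons_tau A w j (hi j (by simp)) g (hg.2 j)
      | some i =>
        apply mem_Um_of_missing A m hm i
        · exact fun j => degreeOf_tau_le w (hg.1 j)
        · intro j hj
          exact cons_tau A w j (hi j (by simpa using hj)) g (hg.2 j)
    | zero =>
      have : (fun j : Fin s => θ ((0 : Fin s → FractionRing (MvPolynomial (Option (Fin n)) K)) j)) = 0 := by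
        ext1 j; simp
      rw [this]; exact Submodule.zero_mem _
    | add x y _ _ hx hy =>
      have : (fun j => θ ((x + y) j)) = (fun j => θ (x j)) + (fun j => θ (y j)) := by
        ext1 j; simp
      rw [this]; exact Submodule.add_mem _ hx hy
    | smul a x _ hx =>
      have : (fun j => θ ((a • x) j)) = θ a • (fun j => θ (x j)) := by
        ext1 j; simp
      rw [this]; exact Submodule.smul_mem _ _ hx
  have h1 : (fun j => θ (emb f j)) = emb (fun j => tau w (f j)) := by
    ext1 j; exact hθ _
  rw [← h1]
  exact key _ hf

lemma exists_pow_ne [Infinite K] {a b : ℕ} (hab : a ≠ b) : ∃ c : K, c ≠ 0 ∧ c ^ a ≠ c ^ b := by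
  have : (X ^ a - X ^ b : K[X]) * X ≠ 0 := by
    apply mul_ne_zero _ Polynomial.X_ne_zero
    rw [sub_ne_zero]
    intro h
    have := congrArg Polynomial.natDegree h
    simp at this
    exact hab this
  by_contra hcon
  push Not at hcon
  apply this
  apply Polynomial.funext
  intro c
  by_cases hc : c = 0
  · simp [hc]
  · simp [hcon c hc]

lemma exists_weight [Infinite K] (μ ν : Option (Fin n) →₀ ℕ) (h : μ ≠ ν) :
    ∃ w : Option (Fin n) → K, (∀ v, w v ≠ 0) ∧
      (∃ i : Option (Fin n), ∀ j, some j ≠ i → w (some j) = w none) ∧ wt w μ ≠ wt w ν := by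
  classical
  have hwt : ∀ (w : Option (Fin n) → K) (μ : Option (Fin n) →₀ ℕ), wt w μ = ∏ v, w v ^ μ v := by
    intro w μ
    rw [wt, Finsupp.prod_fintype]
    simp
  by_cases hs : ∃ i, μ (some i) ≠ ν (some i)
  · obtain ⟨i, hi⟩ := hs
    obtain ⟨c, hc0, hc⟩ := exists_pow_ne (K := K) hi
    refine ⟨Function.update 1 (some i) c, ?_, ⟨some i, ?_⟩, ?_⟩
    · intro v
      by_cases hv : v = some i
      · subst hv; simpa using hc0
      · simp [hv]
    · intro j hj
      simp [hj]
    · have : ∀ μ : Option (Fin n) →₀ ℕ, wt (Function.update (1 : Option (Fin n) → K) (some i) c) μ = c ^ μ (some i) := by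
        intro μ
        rw [hwt, Finset.prod_eq_single (some i)]
        · simp
        · intro v _ hv; simp [hv]
        · simp
      rw [this, this]; exact hc
  · push Not at hs
    have hn : μ none ≠ ν none := by
      intro hn
      apply h
      ext v
      cases v with
      | none => exact hn
      | some i => exact hs i
    have hsum : ∑ v, μ v ≠ ∑ v, ν v := by
      rw [Fintype.sum_option, Fintype.sum_option]
      simp only [hs]
      omega
    obtain ⟨c, hc0, hc⟩ := exists_pow_ne (K := K) hsum
    refine ⟨fun _ => c, fun _ => hc0, ⟨none, fun _ _ => rfl⟩, ?_⟩
    rw [hwt, hwt, Finset.prod_pow_eq_pow_sum, Finset.prod_pow_eq_pow_sum]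
    exact hc

lemma emb_sub (f g : Fin s → MvPolynomial (Option (Fin n)) K) :
    emb (fun j => f j - g j) = emb f - emb g := by
  ext1 j; simp [emb]

lemma coeff_mem_Um [Infinite K] (A : Fin n → Matrix (Fin s) (Fin s) K) (m : ℕ)
    (hm : Um A (m+1) = Um A m) :
    ∀ (N : ℕ) (S : Finset (Option (Fin n) →₀ ℕ)), S.card = N →
    ∀ (f : Fin s → MvPolynomial (Option (Fin n)) K), emb f ∈ Um A m →
    (∀ j μ, μ ∉ S → (f j).coeff μ = 0) →
    ∀ μ, emb (fun j => MvPolynomial.C ((f j).coeff μ)) ∈ Um A m := by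
  classical
  intro N
  induction N with
  | zero =>
    intro S hS f hf hsupp μ
    rw [Finset.card_eq_zero] at hS
    have : emb (n := n) (fun j => MvPolynomial.C ((f j).coeff μ)) = 0 := by
      ext1 j
      simp [emb, hsupp j μ (by simp [hS])]
    rw [this]; exact Submodule.zero_mem _
  | succ N ih =>
    intro S hS f hf hsupp μ
    by_cases hμ : μ ∈ S
    · by_cases hν : ∃ ν ∈ S, μ ≠ ν
      · obtain ⟨ν, hνS, hμν⟩ := hν
        obtain ⟨w, hw, ⟨i, hi⟩, hne⟩ := exists_weight (K := K) μ ν hμν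
        have h1 := tau_mem_Um A m hm w hw i hi f hf
        have h2 : emb (fun j => tau w (f j) - MvPolynomial.C (wt w ν) * f j) ∈ Um A m := by
          rw [emb_sub, emb_smul]
          exact Submodule.sub_mem _ h1 (Submodule.smul_mem _ _ hf)
        have h3 := ih (S.erase ν) (by rw [Finset.card_erase_of_mem hνS]; omega) _ h2 (by
          intro j κ hκ
          rw [MvPolynomial.coeff_sub, coeff_tau, MvPolynomial.coeff_C_mul]
          by_cases hκν : κ = ν
          · subst hκν; ring
          · rw [hsupp j κ (fun h => hκ (Finset.mem_erase.2 ⟨hκν, h⟩))]; ring) μ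
        apply emb_div_mem A m (MvPolynomial.C (wt w μ - wt w ν))
        · rw [Ne, MvPolynomial.C_eq_zero, sub_eq_zero]; exact hne
        · convert h3 using 3 with j
          rw [MvPolynomial.coeff_sub, coeff_tau, MvPolynomial.coeff_C_mul, ← MvPolynomial.C_mul]
          congr 1; ring
      · push Not at hν
        apply emb_div_mem A m (MvPolynomial.monomial μ 1)
        · simp
        · convert hf using 2
          ext1 j
          ext κ
          rw [mul_comm, MvPolynomial.C_mul_monomial, MvPolynomial.coeff_monomial]
          split_ifs with h
          · rw [h, mul_one]
          · exact (hsupp j κ (fun hκ => h (hν κ hκ))).symm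
    · have : emb (n := n) (fun j => MvPolynomial.C ((f j).coeff μ)) = 0 := by
        ext1 j
        simp [emb, hsupp j μ hμ]
      rw [this]; exact Submodule.zero_mem _

end framework

lemma optionEquivLeft_rename_some {K : Type*} [Field K] {n : ℕ} (v : MvPolynomial (Fin n) K) :
    MvPolynomial.optionEquivLeft K (Fin n) (MvPolynomial.rename some v) = Polynomial.C v := by
  induction v using MvPolynomial.induction_on with
  | C a => simp
  | add p q hp hq => simp [hp, hq]
  | mul_X p i hp => simp [hp]

/-- If no specialization is rigid, there is a generic solution. -/
lemma exists_generic_solution {K : Type*} [Field K] [Infinite K] {n s D : ℕ}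
    (V : Fin n → Submodule K (Fin s → K)) (A : Fin n → Matrix (Fin s) (Fin s) K)
    (hA : ∀ i v, v ∈ V i ↔ (A i).mulVec v = 0)
    (h : ∀ β : Fin n → K, ¬ Rigid ⊤ V D β) : ∃ f ∈ Wm A D, f ≠ 0 := by
  classical
  let T : Matrix (Fin n × Fin s) (Fin s × Fin D) (MvPolynomial (Fin n) K) :=
    Matrix.of fun p c => MvPolynomial.C (A p.1 p.2 c.1) * MvPolynomial.X p.1 ^ (c.2 : ℕ)
  obtain ⟨v, hv0, hv⟩ := exists_generic_kernel T (by
    intro β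
    have := h β
    unfold Rigid at this
    push Not at this
    obtain ⟨f, -, hdeg, hf, hf0⟩ := this
    refine ⟨fun c => (f c.1).coeff c.2, ?_, ?_⟩
    · intro h0
      apply hf0
      ext1 j
      ext t
      by_cases ht : t < D
      · exact congrFun h0 (j, ⟨t, ht⟩)
      · rw [Pi.zero_apply, Polynomial.coeff_zero]
        apply Polynomial.coeff_eq_zero_of_degree_lt
        refine (hdeg j).trans_le ?_
        exact_mod_cast not_lt.1 ht
    · ext1 p
      have h1 := congrFun ((hA p.1 _).1 (hf p.1)) p.2
      simp only [Matrix.mulVec, dotProduct, Pi.zero_apply, evalVec_apply] at h1 ⊢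
      rw [← h1, Fintype.sum_prod_type]
      refine Finset.sum_congr rfl fun j _ => ?_
      have h2 : (f j).eval (β p.1) = ∑ t : Fin D, (f j).coeff t * β p.1 ^ (t : ℕ) := by
        by_cases hj : f j = 0
        · simp [hj]
        rw [Polynomial.eval_eq_sum_range' (n := D) (by
          rw [Polynomial.natDegree_lt_iff_degree_lt hj]; exact hdeg j)]
        exact (Fin.sum_univ_eq_sum_range (fun t => (f j).coeff t * β p.1 ^ t) D).symm
      rw [h2, Finset.mul_sum]
      refine Finset.sum_congr rfl fun t _ => ?_
      simp only [T, Matrix.map_apply, Matrix.of_apply, map_mul, map_pow, MvPolynomial.eval_C, MvPolynomial.eval_X]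
      ring)
  let f : Fin s → MvPolynomial (Option (Fin n)) K := fun j =>
    ∑ t : Fin D, MvPolynomial.rename some (v (j, t)) * MvPolynomial.X none ^ (t : ℕ)
  have hfp : ∀ j, MvPolynomial.optionEquivLeft K (Fin n) (f j) =
      ∑ t : Fin D, Polynomial.monomial (t : ℕ) (v (j, t)) := by
    intro j
    simp only [f, map_sum, map_mul, map_pow, optionEquivLeft_rename_some, MvPolynomial.optionEquivLeft_X_none,
      Polynomial.C_mul_X_pow_eq_monomial]
  refine ⟨f, ⟨fun j => ?_, fun i r => ?_⟩, ?_⟩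
  · apply degreeOf_le_of_coeff
    intro μ hμ
    rw [← MvPolynomial.optionEquivLeft_coeff_some_coeff_none, hfp, Polynomial.finsetSum_coeff] at hμ
    by_contra hlt
    apply hμ
    rw [Finset.sum_eq_zero, MvPolynomial.coeff_zero]
    intro t _
    rw [Polynomial.coeff_monomial, if_neg]
    have := t.2
    omega
  · have h1 := congrArg (MvPolynomial.rename (some : Fin n → Option (Fin n))) (congrFun hv (i, r))
    simp only [Matrix.mulVec, dotProduct, Pi.zero_apply, map_zero, map_sum, map_mul, T, Matrix.of_apply, map_pow, MvPolynomial.rename_C, MvPolynomial.rename_X] at h1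
    rw [← h1, Fintype.sum_prod_type]
    refine Finset.sum_congr rfl fun j _ => ?_
    simp only [f, map_sum, map_mul, map_pow]
    rw [Finset.mul_sum]
    refine Finset.sum_congr rfl fun t _ => ?_
    have h3 : ev i (MvPolynomial.rename some (v (j, t))) = MvPolynomial.rename some (v (j, t)) := by
      rw [ev, MvPolynomial.rename_rename]
      rfl
    have h4 : ev i (MvPolynomial.X none : MvPolynomial (Option (Fin n)) K) = MvPolynomial.X (some i) := by
      simp [ev]
    rw [h3, h4]
    ring
  · intro h0
    apply hv0
    ext1 c
    have h1 := hfp c.1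
    rw [h0, Pi.zero_apply, map_zero] at h1
    have h2 := congrArg (fun p => Polynomial.coeff p (c.2 : ℕ)) h1
    simp only [Polynomial.finsetSum_coeff, Polynomial.coeff_monomial, Polynomial.coeff_zero] at h2
    rw [Finset.sum_eq_single c.2] at h2
    · simpa using h2.symm
    · intro b _ hb
      rw [if_neg]
      intro h; exact hb (Fin.ext h)
    · simp

lemma exists_stable {K : Type*} [Field K] {n s D : ℕ} (A : Fin n → Matrix (Fin s) (Fin s) K)
    (hf : ∃ f ∈ Wm A D, f ≠ 0) : ∃ m, D ≤ m ∧ m + 1 ≤ D + s ∧ Um A (m+1) = Um A m := by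
  by_contra hcon
  push Not at hcon
  have key : ∀ t, t ≤ s → t + 1 ≤ finrank (FractionRing (MvPolynomial (Option (Fin n)) K)) (Um A (D + t)) := by
    intro t
    induction t with
    | zero =>
      intro _
      obtain ⟨f, hf, hf0⟩ := hf
      rw [add_zero, zero_add, Nat.succ_le_iff, Module.finrank_pos_iff_exists_ne_zero]
      refine ⟨⟨emb f, Submodule.subset_span ⟨f, hf, rfl⟩⟩, ?_⟩
      intro h
      apply hf0
      ext1 j
      have := congrFun (congrArg Subtype.val h) j
      simpa [emb] using this
    | succ t ih =>
      intro ht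
      have h1 := ih (by omega)
      have h2 := hcon (D + t) (by omega) (by omega)
      have h3 : Um A (D + t) < Um A (D + t + 1) :=
        lt_of_le_of_ne (Um_mono A (by omega)) (Ne.symm h2)
      have h4 := Submodule.finrank_lt_finrank_of_lt h3
      rw [← add_assoc]
      omega
  have h1 := key s le_rfl
  have h2 := Submodule.finrank_le (Um A (D + s))
  simp only [Module.finrank_fin_fun] at h2
  omega

/-- the generic rigidity theorem -/
theorem generic_rigid {K : Type*} [Field K] [Infinite K] {n s : ℕ}
    (V : Fin n → Submodule K (Fin s → K)) (κ : ℝ)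
    (H : ∀ U : Submodule K (Fin s → K), κ * finrank K U ≤
      ∑ i, ((finrank K U : ℝ) - finrank K (U ⊓ V i : Submodule K (Fin s → K))))
    (D : ℕ) (hD : (D : ℝ) + s ≤ κ) : ∃ β : Fin n → K, Rigid ⊤ V D β := by
  classical
  by_contra hcon
  push Not at hcon
  choose A hA using fun i => exists_matrix_of_submodule (V i)
  have hsol := exists_generic_solution V A hA hcon
  obtain ⟨m, hDm, hmD, hm⟩ := exists_stable A hsol
  have hone : ∀ v : Fin s → K, ∀ a : K, emb (n := n) (fun j => MvPolynomial.C (a * v j)) =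
      (algebraMap (MvPolynomial (Option (Fin n)) K) (FractionRing (MvPolynomial (Option (Fin n)) K)) (MvPolynomial.C a)) • emb (fun j => MvPolynomial.C (v j)) := by
    intro v a; ext1 j; simp [emb]
  let U0 : Submodule K (Fin s → K) :=
    { carrier := {v | emb (n := n) (fun j => MvPolynomial.C (v j)) ∈ Um A m}
      add_mem' := by
        intro a b ha hb
        have : emb (n := n) (fun j => MvPolynomial.C ((a + b) j)) =
          emb (fun j => MvPolynomial.C (a j)) + emb (fun j => MvPolynomial.C (b j)) := by
          ext1 j; simp [emb]
        change _ ∈ Um A m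
        rw [this]; exact Submodule.add_mem _ ha hb
      zero_mem' := by
        have : emb (n := n) (s := s) (fun j => MvPolynomial.C ((0 : Fin s → K) j)) = 0 := by
          ext1 j; simp [emb]
        change _ ∈ Um A m
        rw [this]; exact Submodule.zero_mem _
      smul_mem' := by
        intro c a ha
        have := hone a c
        change emb (n := n) (fun j => MvPolynomial.C (c * a j)) ∈ Um A m
        rw [this]; exact Submodule.smul_mem _ _ ha }
  have hU0 : ∀ v, v ∈ U0 ↔ emb (n := n) (fun j => MvPolynomial.C (v j)) ∈ Um A m := fun v => Iff.rfl
  have hcoef : ∀ f, emb f ∈ Um A m → ∀ μ, (fun j => (f j).coeff μ) ∈ U0 := by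
    intro f hf μ
    rw [hU0]
    refine coeff_mem_Um A m hm _ (Finset.univ.biUnion fun j => (f j).support) rfl f hf ?_ μ
    intro j ν hν
    by_contra h
    exact hν (Finset.mem_biUnion.2 ⟨j, Finset.mem_univ _, MvPolynomial.mem_support_iff.2 h⟩)
  have heval : ∀ f, emb f ∈ Um A m → ∀ p : Option (Fin n) → K,
      (fun j => MvPolynomial.eval p (f j)) ∈ U0 := by
    intro f hf p
    have : (fun j => MvPolynomial.eval p (f j)) =
        ∑ μ ∈ Finset.univ.biUnion (fun j => (f j).support), (∏ v, p v ^ μ v) • (fun j => (f j).coeff μ) := by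
      ext1 j
      rw [MvPolynomial.eval_eq', Finset.sum_apply]
      simp only [Pi.smul_apply, smul_eq_mul]
      rw [Finset.sum_subset (Finset.subset_biUnion_of_mem (fun j => (f j).support) (Finset.mem_univ j))]
      · exact Finset.sum_congr rfl fun _ _ => mul_comm _ _
      · intro μ _ hμ
        rw [MvPolynomial.notMem_support_iff.1 hμ, zero_mul]
    rw [this]
    exact Submodule.sum_mem _ fun μ _ => Submodule.smul_mem _ _ (hcoef f hf μ)
  obtain ⟨r, hr⟩ : ∃ r, r = finrank K U0 := ⟨_, rfl⟩
  have hr1 : 1 ≤ r := by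
    obtain ⟨f, hf, hf0⟩ := hsol
    have hfU : emb f ∈ Um A m := Submodule.subset_span ⟨f, Wm_mono A hDm hf, rfl⟩
    have : ∃ μ, (fun j => (f j).coeff μ) ≠ 0 := by
      by_contra hall
      push Not at hall
      apply hf0
      ext1 j
      ext μ
      exact congrFun (hall μ) j
    obtain ⟨μ, hμ⟩ := this
    rw [hr, Nat.succ_le_iff, Module.finrank_pos_iff_exists_ne_zero]
    exact ⟨⟨_, hcoef f hfU μ⟩, fun h => hμ (congrArg Subtype.val h)⟩
  let bas : Basis (Fin r) K U0 := Module.finBasisOfFinrankEq K U0 hr.symm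
  let El : (Fin r → K) →ₗ[K] (Fin s → K) := U0.subtype.comp bas.equivFun.symm.toLinearMap
  have hElinj : Function.Injective El :=
    U0.injective_subtype.comp bas.equivFun.symm.injective
  have hElmem : ∀ c, El c ∈ U0 := fun c => (bas.equivFun.symm c).2
  have hElrange : LinearMap.range El = U0 := by
    apply le_antisymm
    · rintro _ ⟨c, rfl⟩; exact hElmem c
    · intro v hv
      exact ⟨bas.equivFun ⟨v, hv⟩, by simp only [El, LinearMap.comp_apply, LinearEquiv.coe_coe, LinearEquiv.symm_apply_apply, Submodule.subtype_apply]⟩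
  obtain ⟨Xi, hXi⟩ := LinearMap.exists_leftInverse_of_injective El (LinearMap.ker_eq_bot.2 hElinj)
  have hXiE : ∀ c, Xi (El c) = c := fun c => LinearMap.congr_fun hXi c
  have hEXi : ∀ v ∈ U0, El (Xi v) = v := by
    intro v hv
    rw [← hElrange] at hv
    obtain ⟨c, rfl⟩ := hv
    rw [hXiE]
  let M : Matrix (Fin r) (Fin s) K := LinearMap.toMatrix' Xi
  have hM : ∀ v c, Xi v c = ∑ j, M c j * v j := by
    intro v c
    have : M.mulVec v = Xi v := by
      rw [← Matrix.toLin'_apply, Matrix.toLin'_toMatrix']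
    rw [← this]; rfl
  -- reduced solutions
  let red : (Fin s → (MvPolynomial (Option (Fin n)) K)) → (Fin r → (MvPolynomial (Option (Fin n)) K)) := fun f c => ∑ j, MvPolynomial.C (M c j) * f j
  let MQ : Matrix (Fin r) (Fin s) (FractionRing (MvPolynomial (Option (Fin n)) K)) := M.map fun a => algebraMap (MvPolynomial (Option (Fin n)) K) (FractionRing (MvPolynomial (Option (Fin n)) K)) (MvPolynomial.C a)
  have hMQ : ∀ f, MQ.mulVecLin (emb f) = fun c => algebraMap (MvPolynomial (Option (Fin n)) K) (FractionRing (MvPolynomial (Option (Fin n)) K)) (red f c) := by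
    intro f
    ext1 c
    simp [MQ, red, emb, Matrix.mulVec, dotProduct]
  have htop : Submodule.span (FractionRing (MvPolynomial (Option (Fin n)) K)) (MQ.mulVecLin '' (emb '' Wm A m)) = ⊤ := by
    rw [← Submodule.map_span]
    change Submodule.map _ (Um A m) = ⊤
    rw [eq_top_iff, ← (Pi.basisFun (FractionRing (MvPolynomial (Option (Fin n)) K)) (Fin r)).span_eq, Submodule.span_le]
    rintro _ ⟨c, rfl⟩
    refine ⟨emb (fun j => MvPolynomial.C (El (Pi.single c 1) j)), hElmem _, ?_⟩
    rw [hMQ]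
    ext1 c'
    have h1 : red (fun j => MvPolynomial.C (El (Pi.single c 1) j)) c' = MvPolynomial.C ((Pi.single c 1 : Fin r → K) c') := by
      simp only [red, ← MvPolynomial.C_mul]
      rw [← map_sum, ← hM, hXiE]
    rw [h1, Pi.basisFun_apply, Pi.single_apply, Pi.single_apply]
    split_ifs <;> simp
  obtain ⟨b, hbt, hbspan, hbli⟩ := exists_linearIndependent (FractionRing (MvPolynomial (Option (Fin n)) K)) (MQ.mulVecLin '' (emb '' Wm A m))
  rw [htop] at hbspan
  let bb : Basis b (FractionRing (MvPolynomial (Option (Fin n)) K)) (Fin r → (FractionRing (MvPolynomial (Option (Fin n)) K))) := Basis.mk hbli (by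
    rw [Subtype.range_coe]; exact hbspan.ge)
  let e : b ≃ Fin r := bb.indexEquiv (Pi.basisFun (FractionRing (MvPolynomial (Option (Fin n)) K)) (Fin r))
  have hg : ∀ l : Fin r, ∃ f ∈ Wm A m, ((e.symm l : b) : Fin r → (FractionRing (MvPolynomial (Option (Fin n)) K))) = fun c => algebraMap (MvPolynomial (Option (Fin n)) K) (FractionRing (MvPolynomial (Option (Fin n)) K)) (red f c) := by
    intro l
    obtain ⟨_, ⟨f, hf, rfl⟩, h⟩ := hbt (e.symm l).2
    exact ⟨f, hf, by rw [← h, hMQ]⟩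
  choose f hfW hfe using hg
  let G : Matrix (Fin r) (Fin r) (MvPolynomial (Option (Fin n)) K) := Matrix.of fun l c => red (f l) c
  have hGdet : G.det ≠ 0 := by
    intro h0
    have hli : LinearIndependent (FractionRing (MvPolynomial (Option (Fin n)) K)) (fun l => ((e.symm l : b) : Fin r → (FractionRing (MvPolynomial (Option (Fin n)) K)))) :=
      hbli.comp _ e.symm.injective
    have h1 : IsUnit (G.map (algebraMap (MvPolynomial (Option (Fin n)) K) (FractionRing (MvPolynomial (Option (Fin n)) K)))) := by
      rw [← Matrix.linearIndependent_rows_iff_isUnit]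
      have hrow : (G.map (algebraMap (MvPolynomial (Option (Fin n)) K) (FractionRing (MvPolynomial (Option (Fin n)) K)))).row
          = fun l => ((e.symm l : b) : Fin r → FractionRing (MvPolynomial (Option (Fin n)) K)) := by
        ext1 l
        rw [hfe l]; rfl
      rw [hrow]
      exact hli
    rw [Matrix.isUnit_iff_isUnit_det] at h1
    have h2 : (G.map (algebraMap (MvPolynomial (Option (Fin n)) K) (FractionRing (MvPolynomial (Option (Fin n)) K)))).det = algebraMap (MvPolynomial (Option (Fin n)) K) (FractionRing (MvPolynomial (Option (Fin n)) K)) G.det := (RingHom.map_det (algebraMap (MvPolynomial (Option (Fin n)) K) (FractionRing (MvPolynomial (Option (Fin n)) K))) G).symm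
    rw [h2, h0, map_zero] at h1
    exact not_isUnit_zero h1
  -- choose a good point
  let Δ : (MvPolynomial (Option (Fin n)) K) := G.det * ∏ p ∈ (Finset.univ : Finset (Fin n)).offDiag,
    (MvPolynomial.X (some p.1) - MvPolynomial.X (some p.2))
  have hΔ : Δ ≠ 0 := by
    apply mul_ne_zero hGdet
    rw [Finset.prod_ne_zero_iff]
    intro p hp
    rw [sub_ne_zero]
    intro h
    have := MvPolynomial.X_injective h
    rw [Finset.mem_offDiag] at hp
    exact hp.2.2 (Option.some.inj this)
  obtain ⟨p, hp⟩ : ∃ p : Option (Fin n) → K, MvPolynomial.eval p Δ ≠ 0 := by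
    by_contra hne
    push Not at hne
    exact hΔ (MvPolynomial.funext (fun x => by simpa using hne x))
  rw [map_mul, map_prod] at hp
  have hp1 := left_ne_zero_of_mul hp
  have hp2 := Finset.prod_ne_zero_iff.1 (right_ne_zero_of_mul hp)
  have hinj : Function.Injective (fun i => p (some i)) := by
    intro i j hij
    by_contra hne
    apply hp2 (i, j) (Finset.mem_offDiag.2 ⟨Finset.mem_univ _, Finset.mem_univ _, hne⟩)
    simp only [map_sub, MvPolynomial.eval_X, sub_eq_zero]
    exact hij
  let θ : (MvPolynomial (Option (Fin n)) K) →ₐ[K] K[X] := MvPolynomial.aeval fun v => v.elim X (fun i => C (p (some i)))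
  have hθeval : ∀ (x : K) (g : (MvPolynomial (Option (Fin n)) K)), (θ g).eval x =
      MvPolynomial.eval (fun v : Option (Fin n) => v.elim x (fun i => p (some i))) g := by
    intro x g
    induction g using MvPolynomial.induction_on with
    | C a => simp [θ]
    | add a b ha hb => rw [map_add, Polynomial.eval_add, ha, hb, map_add]
    | mul_X a v ha =>
      rw [map_mul, Polynomial.eval_mul, ha, map_mul, MvPolynomial.eval_X]
      congr 1
      cases v <;> simp [θ]
  have hθdeg : ∀ g : (MvPolynomial (Option (Fin n)) K), g.degreeOf none ≤ m → (θ g).natDegree ≤ m := by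
    intro g hg
    rw [MvPolynomial.as_sum g, map_sum]
    apply Polynomial.natDegree_sum_le_of_forall_le
    intro μ hμ
    have h1 : θ (MvPolynomial.monomial μ (g.coeff μ)) =
        C (g.coeff μ * ∏ i, p (some i) ^ μ (some i)) * X ^ μ none := by
      simp only [θ]
      rw [MvPolynomial.aeval_monomial, Finsupp.prod_fintype _ _ (by simp), Fintype.prod_option]
      simp only [Option.elim, Polynomial.algebraMap_eq, map_mul, map_prod, map_pow]
      ring
    rw [h1]
    refine (Polynomial.natDegree_C_mul_X_pow_le _ _).trans ?_
    exact le_of_degreeOf hg μ (MvPolynomial.mem_support_iff.1 hμ)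
  have hdetθ : (Matrix.of fun l c => θ (G l c)).det = θ G.det := (AlgHom.map_det θ G).symm
  have hcount := det_count (m := m) (Matrix.of fun l c => θ (G l c))
    (by
      rw [hdetθ]
      intro h0
      have := hθeval (p none) G.det
      rw [h0] at this
      apply hp1
      rw [Polynomial.eval_zero] at this
      rw [this]
      congr 2
      ext1 v
      cases v <;> rfl)
    (by
      intro l c
      have : θ (G l c) = ∑ j, C (M c j) * θ (f l j) := by
        simp [G, red, θ]
      rw [Matrix.of_apply, this]
      apply Polynomial.natDegree_sum_le_of_forall_le
      intro j _
      exact (Polynomial.natDegree_C_mul_le _ _).trans (hθdeg _ ((hfW l).1 j)))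
    (fun i => p (some i)) hinj (fun i => (V i).comap El)
    (by
      intro i l
      rw [Submodule.mem_comap]
      let u : Fin s → K := fun j => MvPolynomial.eval (fun v : Option (Fin n) => v.elim (p (some i)) (fun i => p (some i))) (f l j)
      have hu : u ∈ U0 := heval (f l) (Submodule.subset_span ⟨f l, hfW l, rfl⟩) _
      have h1 : evalVec (p (some i)) ((Matrix.of fun l c => θ (G l c)) l) = Xi u := by
        ext1 c
        rw [evalVec_apply, Matrix.of_apply, hθeval, hM]
        simp only [G, red, Matrix.of_apply, map_sum, map_mul, MvPolynomial.eval_C, u]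
      rw [h1, hEXi u hu, hA]
      ext1 t
      have h2 := congrArg (MvPolynomial.eval p) ((hfW l).2 i t)
      rw [map_zero, map_sum] at h2
      simp only [Matrix.mulVec, dotProduct, Pi.zero_apply]
      rw [← h2]
      refine Finset.sum_congr rfl fun j _ => ?_
      rw [map_mul, MvPolynomial.eval_C, ev, MvPolynomial.eval_rename]
      have hpt : (fun v : Option (Fin n) => v.elim (p (some i)) (fun i => p (some i))) =
          p ∘ (fun v : Option (Fin n) => some (v.getD i)) := by
        ext1 v
        cases v <;> rfl
      simp only [u, hpt])
  -- dimension count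
  have hYdim : ∀ i, finrank K ((V i).comap El) = finrank K (U0 ⊓ V i : Submodule K (Fin s → K)) := by
    intro i
    rw [← hElrange, ← Submodule.map_comap_eq]
    exact (LinearEquiv.finrank_eq (Submodule.equivMapOfInjective El hElinj _))
  have hH := H U0
  rw [← hr] at hH
  have hle : ∀ i, finrank K (U0 ⊓ V i : Submodule K (Fin s → K)) ≤ r := by
    intro i; rw [hr]; exact Submodule.finrank_mono inf_le_left
  have hcast : ((∑ i, (r - finrank K ((V i).comap El)) : ℕ) : ℝ) =
      ∑ i, ((r : ℝ) - finrank K (U0 ⊓ V i : Submodule K (Fin s → K))) := by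
    rw [Nat.cast_sum]
    refine Finset.sum_congr rfl fun i _ => ?_
    rw [hYdim, Nat.cast_sub (hle i)]
  have h3 : ((∑ i, (r - finrank K ((V i).comap El)) : ℕ) : ℝ) ≤ (r : ℝ) * m := by
    exact_mod_cast hcount
  rw [hcast] at h3
  have h4 : (r : ℝ) * ((m : ℝ) + 1) ≤ r * m := by
    have : (m : ℝ) + 1 ≤ D + s := by exact_mod_cast hmD
    calc (r : ℝ) * ((m : ℝ) + 1) ≤ r * κ := by
          apply mul_le_mul_of_nonneg_left _ (Nat.cast_nonneg r); linarith
      _ = κ * r := mul_comm _ _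
      _ ≤ _ := hH
      _ ≤ _ := h3
  have : (1 : ℝ) ≤ r := by exact_mod_cast hr1
  linarith

lemma finrank_map_add_ker {K : Type*} [Field K] {b s : ℕ} (π : (Fin b → K) →ₗ[K] (Fin s → K))
    (W : Submodule K (Fin b → K)) :
    finrank K (W.map π) + finrank K (W ⊓ LinearMap.ker π : Submodule K (Fin b → K)) = finrank K W := by
  have h := LinearMap.finrank_range_add_finrank_ker (π.comp W.subtype)
  rw [LinearMap.range_comp, Submodule.range_subtype] at h
  rw [← h]
  congr 1
  have h2 : (LinearMap.ker (π.comp W.subtype)).map W.subtype = W ⊓ LinearMap.ker π := by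
    ext x
    simp only [Submodule.mem_map, LinearMap.mem_ker, LinearMap.comp_apply, Submodule.subtype_apply,
      Submodule.mem_inf]
    constructor
    · rintro ⟨y, hy, rfl⟩; exact ⟨y.2, hy⟩
    · rintro ⟨h1, h2⟩; exact ⟨⟨x, h1⟩, h2, rfl⟩
  rw [← h2]
  exact (LinearEquiv.finrank_eq (Submodule.equivMapOfInjective W.subtype W.injective_subtype _)).symm

/-- counting bad evaluation points for a fixed pattern -/
theorem pattern_count {K F : Type*} [Field K] [Infinite K] [Field F] [Fintype F] [Algebra F K]
    {b ℓ n : ℕ} (hn : 0 < n) (φ : Fin n → Fin b → Option (Fin ℓ))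
    (R ε : ℝ) (hε : 0 < ε) (hℓε : 1 ≤ ℓ / ε)
    (hagr : ∀ a, (R + ε) * n ≤ ((Finset.univ.filter fun i => φ i a ≠ none).card : ℝ))
    (hb : (ℓ / ε : ℝ) ^ (ℓ / ε : ℝ) < b) (k e : ℕ) (hke : (k : ℝ) + e + b ≤ R * n) :
    (({α : Fin n → F | ∃ f : Fin b → F[X], Function.Injective f ∧
        (∀ a, (f a).degree < (k : WithBot ℕ)) ∧
        ∀ i a a', φ i a ≠ none → φ i a = φ i a' → (f a).eval (α i) = (f a').eval (α i)}).ncard : ℝ) *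
        (Fintype.card F : ℝ) ^ e ≤
        (n.choose e : ℝ) * (b * (k + e) : ℝ) ^ e * (Fintype.card F : ℝ) ^ n := by
  classical
  obtain ⟨U', ⟨a0, a1, ha01, hU'⟩, hcore⟩ := exists_core (K := K) hn φ R ε hε hℓε hagr hb
  obtain ⟨s, hs⟩ : ∃ s, s = finrank K ((Fin b → K) ⧸ U') := ⟨_, rfl⟩
  let bas : Basis (Fin s) K ((Fin b → K) ⧸ U') := Module.finBasisOfFinrankEq K _ hs.symm
  let π : (Fin b → K) →ₗ[K] (Fin s → K) := bas.equivFun.toLinearMap.comp U'.mkQ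
  have hπs : Function.Surjective π :=
    bas.equivFun.surjective.comp U'.mkQ_surjective
  have hπk : LinearMap.ker π = U' := by
    simp only [π]
    rw [LinearEquiv.ker_comp, Submodule.ker_mkQ]
  have hsb : s ≤ b := by
    have := Submodule.finrank_quotient_le U'
    rw [← hs] at this
    simpa using this
  let V : Fin n → Submodule K (Fin s → K) := fun i => (patV K (φ i)).map π
  have hV : ∀ U : Submodule K (Fin s → K), R * n * finrank K U ≤
      ∑ i, ((finrank K U : ℝ) - finrank K (U ⊓ V i : Submodule K (Fin s → K))) := by
    intro U
    have hle : U' ≤ U.comap π := by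
      intro x hx
      rw [← hπk, LinearMap.mem_ker] at hx
      rw [Submodule.mem_comap, hx]; exact U.zero_mem
    have h1 := hcore (U.comap π) hle
    have h2 : (finrank K U : ℝ) = finrank K (U.comap π) - finrank K U' := by
      have := finrank_map_add_ker π (U.comap π)
      rw [Submodule.map_comap_eq_of_surjective hπs, hπk, inf_eq_right.2 hle] at this
      rw [← this]; push_cast; ring
    have h3 : ∀ i, (finrank K (U ⊓ V i : Submodule K (Fin s → K)) : ℝ) =
        finrank K (U.comap π ⊓ patV K (φ i) : Submodule K (Fin b → K)) -
        finrank K (U' ⊓ patV K (φ i) : Submodule K (Fin b → K)) := by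
      intro i
      have := finrank_map_add_ker π (U.comap π ⊓ patV K (φ i))
      have h4 : (U.comap π ⊓ patV K (φ i)).map π = U ⊓ V i := by
        ext x
        simp only [V, Submodule.mem_map, Submodule.mem_inf, Submodule.mem_comap]
        constructor
        · rintro ⟨y, ⟨h1, h2⟩, rfl⟩; exact ⟨h1, y, h2, rfl⟩
        · rintro ⟨h1, y, h2, rfl⟩; exact ⟨y, ⟨h1, h2⟩, rfl⟩
      have h5 : (U.comap π ⊓ patV K (φ i)) ⊓ LinearMap.ker π = U' ⊓ patV K (φ i) := by
        rw [hπk]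
        apply le_antisymm
        · exact le_inf inf_le_right (inf_le_left.trans inf_le_right)
        · exact le_inf (le_inf (inf_le_left.trans hle) inf_le_right) inf_le_left
      rw [h4, h5] at this
      rw [← this]; push_cast; ring
    rw [h2]
    refine h1.trans (le_of_eq ?_)
    refine Finset.sum_congr rfl fun i _ => ?_
    rw [h3]; ring
  have hsb' : (s : ℝ) ≤ b := by exact_mod_cast hsb
  have hrig := generic_rigid V (R * n) hV (k + e) (by push_cast; linarith)
  have hcount := count_bad (F := F) k e n ⊤ V e le_rfl hrig
  have hsub : {α : Fin n → F | ∃ f : Fin b → F[X], Function.Injective f ∧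
        (∀ a, (f a).degree < (k : WithBot ℕ)) ∧
        ∀ i a a', φ i a ≠ none → φ i a = φ i a' → (f a).eval (α i) = (f a').eval (α i)} ⊆
      {α : Fin n → F | ¬ Rigid ⊤ V k (fun i => algebraMap F K (α i))} := by
    rintro α ⟨f, hfinj, hdeg, hf⟩ hR
    let g : Fin b → K[X] := fun a => (f a).map (algebraMap F K)
    let M : Matrix (Fin s) (Fin b) K := LinearMap.toMatrix' π
    have hM : ∀ v c, π v c = ∑ j, M c j * v j := by
      intro v c
      have : M.mulVec v = π v := by
        rw [← Matrix.toLin'_apply, Matrix.toLin'_toMatrix']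
      rw [← this]; rfl
    have h0 := hR (fun c => ∑ a, C (M c a) * g a) trivial (by
      intro c
      rw [← Polynomial.mem_degreeLT]
      refine Submodule.sum_mem _ fun a _ => ?_
      rw [Polynomial.mem_degreeLT]
      refine lt_of_le_of_lt ?_ (hdeg a)
      calc (C (M c a) * g a).degree ≤ (g a).degree := by
            rw [← Polynomial.smul_eq_C_mul]; exact Polynomial.degree_smul_le _ _
        _ ≤ (f a).degree := Polynomial.degree_map_le)
      (by
        intro i
        refine ⟨evalVec (algebraMap F K (α i)) g, ?_, ?_⟩
        · intro a a' h1 h2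
          simp only [evalVec_apply, g, Polynomial.eval_map_algebraMap, Polynomial.aeval_algebraMap_apply]
          rw [Polynomial.coe_aeval_eq_eval, hf i a a' h1 h2]
        · ext1 c
          rw [hM]
          simp [Polynomial.eval_finsetSum])
    apply ha01
    apply hfinj
    apply Polynomial.map_injective (algebraMap F K) (algebraMap F K).injective
    ext t
    apply hU' (fun a => (g a).coeff t)
    rw [← hπk, LinearMap.mem_ker]
    ext1 c
    rw [hM]
    have := congrArg (fun p : K[X] => p.coeff t) (congrFun h0 c)
    simpa [Polynomial.finsetSum_coeff] using this
  have hq0 : (0 : ℝ) ≤ (Fintype.card F : ℝ) := Nat.cast_nonneg _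
  calc _ ≤ (({α : Fin n → F | ¬ Rigid ⊤ V k (fun i => algebraMap F K (α i))}).ncard : ℝ) *
        (Fintype.card F : ℝ) ^ e := by
        apply mul_le_mul_of_nonneg_right _ (pow_nonneg hq0 _)
        exact_mod_cast Set.ncard_le_ncard hsub (Set.toFinite _)
    _ ≤ _ := hcount
    _ ≤ _ := by
        apply mul_le_mul_of_nonneg_right _ (pow_nonneg hq0 _)
        apply mul_le_mul_of_nonneg_left _ (Nat.cast_nonneg _)
        apply pow_le_pow_left₀ (by positivity)
        apply mul_le_mul_of_nonneg_right hsb' (by positivity)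

lemma choose_bound (n e : ℕ) (he : 1 ≤ e) : (n.choose e : ℝ) ≤ (3 * n / e) ^ e := by
  have he0 : (0 : ℝ) < e := by exact_mod_cast he
  have h1 : (n.choose e : ℝ) ≤ (n : ℝ) ^ e / e.factorial := Nat.choose_le_pow_div e n
  have h2 : (e : ℝ) ^ e / e.factorial ≤ Real.exp e := Real.pow_div_factorial_le_exp e he0.le e
  have h3 : Real.exp e ≤ 3 ^ e := by
    rw [← mul_one (e : ℝ), Real.exp_nat_mul]
    apply pow_le_pow_left₀ (Real.exp_pos 1).le
    have := Real.exp_one_lt_d9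
    linarith
  have hf : (0 : ℝ) < e.factorial := by exact_mod_cast Nat.factorial_pos e
  have h4 : (1 : ℝ) / e.factorial ≤ 3 ^ e / e ^ e := by
    rw [le_div_iff₀ (pow_pos he0 e)]
    calc 1 / (e.factorial : ℝ) * e ^ e = e ^ e / e.factorial := by ring
      _ ≤ _ := h2.trans h3
  calc (n.choose e : ℝ) ≤ (n : ℝ) ^ e * (1 / e.factorial) := by rw [mul_one_div]; exact h1
    _ ≤ (n : ℝ) ^ e * (3 ^ e / e ^ e) := mul_le_mul_of_nonneg_left h4 (by positivity)
    _ = _ := by rw [div_pow, mul_pow]; ring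

lemma numeric_bound (R ε' η : ℝ) (hR0 : 0 < R) (hε'0 : 0 < ε') (hη : 0 < η) (ℓ b n k e q : ℕ)
    (hℓ : 0 < ℓ) (hb : 1 ≤ b) (hn : 0 < n)
    (he1 : ε' * n / (2 * b) ≤ e) (hke : (k : ℝ) + e ≤ R * n)
    (hq : (4 * (b : ℝ)) ^ (4 * b) * R * (n : ℝ) / ε' *
        (2 : ℝ) ^ (((Real.logb 2 (ℓ : ℝ) + 2) * (b : ℝ) + η) * 2 * (b : ℝ) / ε') < (q : ℝ))
    (N : ℝ) (hN0 : 0 ≤ N)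
    (hN : N * (q : ℝ) ^ e ≤ (n.choose e : ℝ) * (b * (k + e) : ℝ) ^ e * (q : ℝ) ^ n) :
    N * ((4 * (ℓ : ℝ)) ^ (b * n) * (2 : ℝ) ^ (η * n)) ≤ (q : ℝ) ^ n := by
  have hb0 : (0 : ℝ) < b := by exact_mod_cast hb
  have hb1 : (1 : ℝ) ≤ b := by exact_mod_cast hb
  have hn0 : (0 : ℝ) < n := by exact_mod_cast hn
  have hℓ0 : (0 : ℝ) < ℓ := by exact_mod_cast hℓ
  have hℓ1 : (1 : ℝ) ≤ ℓ := by exact_mod_cast hℓ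
  have hepos : (0 : ℝ) < e := lt_of_lt_of_le (by positivity) he1
  have he : 1 ≤ e := by
    have : 0 < e := by exact_mod_cast hepos
    exact this
  have hlog : 0 ≤ Real.logb 2 (ℓ : ℝ) := Real.logb_nonneg (by norm_num) hℓ1
  obtain ⟨c, hc⟩ : ∃ c : ℝ, c = (Real.logb 2 (ℓ : ℝ) + 2) * (b : ℝ) + η := ⟨_, rfl⟩
  rw [← hc] at hq
  have hc0 : 0 ≤ c := by rw [hc]; positivity
  obtain ⟨B, hBdef⟩ : ∃ B : ℝ, B = (2 : ℝ) ^ (c * 2 * (b : ℝ) / ε') := ⟨_, rfl⟩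
  rw [← hBdef] at hq
  have hBpos : 0 < B := by rw [hBdef]; positivity
  have hBe : (4 * (ℓ : ℝ)) ^ (b * n) * (2 : ℝ) ^ (η * n) ≤ B ^ e := by
    have h1 : (4 * (ℓ : ℝ)) = (2 : ℝ) ^ (Real.logb 2 (ℓ : ℝ) + 2) := by
      rw [Real.rpow_add (by norm_num), Real.rpow_logb (by norm_num) (by norm_num) hℓ0]
      norm_num; ring
    have h2 : (4 * (ℓ : ℝ)) ^ (b * n) * (2 : ℝ) ^ (η * n) = (2 : ℝ) ^ (c * n) := by
      rw [h1, ← Real.rpow_natCast, ← Real.rpow_mul (by norm_num), ← Real.rpow_add (by norm_num), hc]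
      congr 1
      push_cast; ring
    rw [h2, hBdef, ← Real.rpow_natCast, ← Real.rpow_mul (by norm_num)]
    apply Real.rpow_le_rpow_of_exponent_le (by norm_num)
    calc c * n = c * 2 * b / ε' * (ε' * n / (2 * b)) := by field_simp
      _ ≤ _ := mul_le_mul_of_nonneg_left he1 (by positivity)
  have hpow : 6 * (b : ℝ) ^ 2 ≤ (4 * (b : ℝ)) ^ (4 * b) := by
    calc 6 * (b : ℝ) ^ 2 ≤ (4 * (b : ℝ)) ^ 2 := by nlinarith [sq_nonneg (b : ℝ)]
      _ ≤ _ := pow_le_pow_right₀ (by linarith) (by omega)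
  have hqB : (6 * (b : ℝ) ^ 2 * R * n / ε') * B ≤ q := by
    refine le_trans ?_ hq.le
    gcongr
  have hqpos : (0 : ℝ) < q := lt_of_lt_of_le (by positivity) hqB
  have hmain : (n.choose e : ℝ) * (b * (k + e) : ℝ) ^ e ≤ (6 * (b : ℝ) ^ 2 * R * n / ε') ^ e := by
    have h1 := choose_bound n e he
    have h2 : (3 * (n : ℝ) / e) ≤ 6 * b / ε' := by
      rw [div_le_div_iff₀ hepos hε'0]
      rw [div_le_iff₀ (by positivity)] at he1
      nlinarith
    calc (n.choose e : ℝ) * (b * (k + e) : ℝ) ^ e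
        ≤ (6 * b / ε') ^ e * (b * (R * n)) ^ e := by
          apply mul_le_mul
          · exact h1.trans (pow_le_pow_left₀ (by positivity) h2 e)
          · apply pow_le_pow_left₀ (by positivity)
            exact mul_le_mul_of_nonneg_left hke hb0.le
          · positivity
          · positivity
      _ = _ := by rw [← mul_pow]; congr 1; ring
  have hfin : N * B ^ e * (q : ℝ) ^ e ≤ (q : ℝ) ^ n * (q : ℝ) ^ e := by
    calc N * B ^ e * (q : ℝ) ^ e = N * (q : ℝ) ^ e * B ^ e := by ring
      _ ≤ ((n.choose e : ℝ) * (b * (k + e) : ℝ) ^ e * (q : ℝ) ^ n) * B ^ e := by gcongr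
      _ ≤ ((6 * (b : ℝ) ^ 2 * R * n / ε') ^ e * (q : ℝ) ^ n) * B ^ e := by gcongr
      _ = (q : ℝ) ^ n * ((6 * (b : ℝ) ^ 2 * R * n / ε') * B) ^ e := by rw [mul_pow]; ring
      _ ≤ _ := by gcongr
  have := le_of_mul_le_mul_right hfin (pow_pos hqpos e)
  exact (mul_le_mul_of_nonneg_left hBe hN0).trans this

end RSLR

/-- Randomly punctured Reed–Solomon codes of rate `R - ε'` over a field of size
`q > ((4(L+1))^{4(L+1)}·Rn/ε')·2^{((log₂ℓ + 2)(L+1) + η)·2(L+1)/ε'}` are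
`(1-R-ε, ℓ, L)`-list-recoverable with `L = ⌊(2ℓ/ε)^{2ℓ/ε}⌋`, with probability at least
`1 - 2^{-ηn}` over the independent uniformly random evaluation points. -/
theorem random_reed_solomon_codes_achieve_list_recovery_capacity
    (R ε : ℝ) (hR0 : 0 < R) (hR1 : R < 1) (hε : 0 < ε) (hcap : 0 < 1 - R - ε)
    (ℓ : ℕ) (hℓ : 0 < ℓ) (ε' : ℝ) (hε'0 : 0 < ε') (hε'R : ε' < R) (η : ℝ) (hη : 0 < η)
    (L : ℕ) (hL : L = ⌊(2 * (ℓ : ℝ) / ε) ^ (2 * (ℓ : ℝ) / ε)⌋₊)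
    (n : ℕ) (hn : 0 < n)
    (hn_large : 2 * ((L : ℝ) + 1) * ((L : ℝ) + 2) ≤ ε' * (n : ℝ))
    (k : ℕ) (hk : (k : ℝ) = (R - ε') * (n : ℝ))
    (q : ℕ) (F : Type*) [Field F] [Fintype F] [DecidableEq F] (hF : Fintype.card F = q)
    (hq : (4 * ((L : ℝ) + 1)) ^ (4 * (L + 1)) * R * (n : ℝ) / ε' *
        (2 : ℝ) ^ (((Real.logb 2 (ℓ : ℝ) + 2) * ((L : ℝ) + 1) + η) * 2 * ((L : ℝ) + 1) / ε')
        < (q : ℝ)) :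
    1 - (2 : ℝ) ^ (-(η * (n : ℝ)) : ℝ) ≤
      (({α : Fin n → F |
          ListRecoverable (RSCode α k) (1 - R - ε) ℓ L}).ncard : ℝ) /
        ((Fintype.card (Fin n → F)) : ℝ) := by
  classical
  have hn0 : (0 : ℝ) < n := by exact_mod_cast hn
  have hℓ0 : (0 : ℝ) < ℓ := by exact_mod_cast hℓ
  have hℓ1 : (1 : ℝ) ≤ ℓ := by exact_mod_cast hℓ
  have hε1 : ε < 1 := by linarith
  have hℓε : 1 ≤ (ℓ : ℝ) / ε := by
    rw [le_div_iff₀ hε]; linarith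
  obtain ⟨b, hbL⟩ : ∃ b : ℕ, b = L + 1 := ⟨_, rfl⟩
  have hbLr : (b : ℝ) = (L : ℝ) + 1 := by rw [hbL]; push_cast; ring
  have hb1 : (1 : ℝ) ≤ b := by rw [hbLr]; linarith [Nat.cast_nonneg (α := ℝ) L]
  have hb : ((ℓ : ℝ) / ε) ^ ((ℓ : ℝ) / ε) < b := by
    rw [hbLr, hL]
    refine lt_of_le_of_lt ?_ (Nat.lt_floor_add_one _)
    have h2 : (ℓ : ℝ) / ε ≤ 2 * ℓ / ε := by gcongr; linarith
    calc ((ℓ : ℝ) / ε) ^ ((ℓ : ℝ) / ε) ≤ ((ℓ : ℝ) / ε) ^ (2 * (ℓ : ℝ) / ε) :=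
          Real.rpow_le_rpow_of_exponent_le hℓε h2
      _ ≤ _ := Real.rpow_le_rpow (by linarith) h2 (by linarith)
  obtain ⟨e, he⟩ : ∃ e : ℕ, e = ⌈ε' * n / (2 * b)⌉₊ := ⟨_, rfl⟩
  have he1 : ε' * n / (2 * b) ≤ e := by rw [he]; exact Nat.le_ceil _
  have he2 : (e : ℝ) < ε' * n / (2 * b) + 1 := by
    rw [he]; exact Nat.ceil_lt_add_one (by positivity)
  have hx : 2 * (b : ℝ) * (b + 1) ≤ ε' * n := by
    rw [hbLr]; calc _ = 2 * ((L : ℝ) + 1) * ((L : ℝ) + 2) := by ring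
      _ ≤ _ := hn_large
  have hke : (k : ℝ) + e + b ≤ R * n := by
    have h1 : ε' * n / (2 * b) ≤ ε' * n / 2 := by
      apply div_le_div_of_nonneg_left (by positivity) (by norm_num) (by linarith)
    rw [hk]
    nlinarith
  -- the bad sets
  let bad : (Fin n → Fin b → Option (Fin ℓ)) → Set (Fin n → F) := fun φ =>
    {α : Fin n → F | ∃ f : Fin b → Polynomial F, Function.Injective f ∧
        (∀ a, (f a).degree < (k : WithBot ℕ)) ∧
        ∀ i a a', φ i a ≠ none → φ i a = φ i a' → (f a).eval (α i) = (f a').eval (α i)}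
  let good : Finset (Fin n → Fin b → Option (Fin ℓ)) := Finset.univ.filter fun φ =>
    ∀ a, (R + ε) * n ≤ ((Finset.univ.filter fun i => φ i a ≠ none).card : ℝ)
  have hbadcount : ∀ φ ∈ good, ((bad φ).ncard : ℝ) * ((4 * (ℓ : ℝ)) ^ (b * n) * (2 : ℝ) ^ (η * n)) ≤ (q : ℝ) ^ n := by
    intro φ hφ
    have hc := RSLR.pattern_count (K := AlgebraicClosure F) (F := F) hn φ R ε hε hℓε
      (Finset.mem_filter.1 hφ).2 hb k e hke
    rw [hF] at hc
    refine RSLR.numeric_bound R ε' η hR0 hε'0 hη ℓ b n k e q hℓ (by omega) hn he1 (by linarith) ?_ _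
      (Nat.cast_nonneg _) hc
    rw [← hbL, ← hbLr] at hq
    exact hq
  have hsub : {α : Fin n → F | ¬ ListRecoverable (RSCode α k) (1 - R - ε) ℓ L} ⊆ ⋃ φ ∈ good, bad φ := by
    intro α hα
    change ¬ ListRecoverable (RSCode α k) (1 - R - ε) ℓ L at hα
    unfold ListRecoverable at hα
    push Not at hα
    obtain ⟨S, hS, hcard⟩ := hα
    obtain ⟨T, hTsub, hTcard⟩ := Set.exists_subset_card_eq (Nat.succ_le_iff.2 hcard)
    have hTfin : T.Finite := Set.toFinite T
    have hTnat : Nat.card T = b := by rw [hbL]; exact hTcard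
    let eT : T ≃ Fin b := Finite.equivFinOfCardEq hTnat
    let x : Fin b → (Fin n → F) := fun a => (eT.symm a : Fin n → F)
    have hxinj : Function.Injective x := Subtype.val_injective.comp eT.symm.injective
    have hxmem : ∀ a, x a ∈ RSCode α k ∧ (1 - (1 - R - ε)) * (n : ℝ) ≤ ((agr (x a) S).card : ℝ) :=
      fun a => hTsub (eT.symm a).2
    have hp : ∀ a, ∃ p : Polynomial F, p.degree < (k : WithBot ℕ) ∧ x a = fun i => p.eval (α i) :=
      fun a => (hxmem a).1
    choose f hfdeg hfx using hp
    let φ : Fin n → Fin b → Option (Fin ℓ) := fun i a =>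
      if h : x a i ∈ S i then some ((S i).equivFinOfCardEq (hS i) ⟨x a i, h⟩) else none
    have hφ : ∀ i a, φ i a ≠ none ↔ x a i ∈ S i := by
      intro i a
      by_cases h : x a i ∈ S i <;> simp [φ, h]
    refine Set.mem_iUnion₂.2 ⟨φ, ?_, f, ?_, hfdeg, ?_⟩
    · refine Finset.mem_filter.2 ⟨Finset.mem_univ _, fun a => ?_⟩
      have h1 := (hxmem a).2
      have h2 : (Finset.univ.filter fun i => φ i a ≠ none) = agr (x a) S := by
        ext i
        simp only [agr, Finset.mem_filter, Finset.mem_univ, true_and, hφ]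
      rw [h2]
      linarith
    · intro a a' h
      apply hxinj
      rw [hfx a, hfx a', h]
    · intro i a a' h1 h2
      have h3 := (hφ i a).1 h1
      have h4 := (hφ i a').1 (h2 ▸ h1)
      simp only [φ, dif_pos h3, dif_pos h4, Option.some.injEq] at h2
      have h5 := congrArg Subtype.val (Equiv.injective _ h2)
      simp only at h5
      rw [hfx a, hfx a'] at h5
      exact h5
  have hW : (0 : ℝ) < (4 * (ℓ : ℝ)) ^ (b * n) * (2 : ℝ) ^ (η * n) := by positivity
  have hbadtotal : (({α : Fin n → F | ¬ ListRecoverable (RSCode α k) (1 - R - ε) ℓ L}).ncard : ℝ) *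
      (2 : ℝ) ^ (η * n) ≤ (q : ℝ) ^ n := by
    have h1 : ({α : Fin n → F | ¬ ListRecoverable (RSCode α k) (1 - R - ε) ℓ L}).ncard ≤
        ∑ φ ∈ good, (bad φ).ncard := by
      refine (Set.ncard_le_ncard hsub (Set.toFinite _)).trans ?_
      exact Finset.set_ncard_biUnion_le good bad
    have h2 : (good.card : ℝ) ≤ (4 * (ℓ : ℝ)) ^ (b * n) := by
      have h3 : good.card ≤ ((ℓ + 1) ^ b) ^ n := by
        refine (Finset.card_le_univ good).trans ?_
        simp
      calc (good.card : ℝ) ≤ (((ℓ + 1) ^ b) ^ n : ℕ) := by exact_mod_cast h3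
        _ = ((ℓ : ℝ) + 1) ^ (b * n) := by push_cast; rw [pow_mul]
        _ ≤ _ := by
          apply pow_le_pow_left₀ (by positivity)
          linarith
    have h4 : (({α : Fin n → F | ¬ ListRecoverable (RSCode α k) (1 - R - ε) ℓ L}).ncard : ℝ) *
        ((4 * (ℓ : ℝ)) ^ (b * n) * (2 : ℝ) ^ (η * n)) ≤ (4 * (ℓ : ℝ)) ^ (b * n) * (q : ℝ) ^ n := by
      calc _ ≤ (∑ φ ∈ good, ((bad φ).ncard : ℝ)) * ((4 * (ℓ : ℝ)) ^ (b * n) * (2 : ℝ) ^ (η * n)) := by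
            apply mul_le_mul_of_nonneg_right _ hW.le
            exact_mod_cast h1
        _ = ∑ φ ∈ good, ((bad φ).ncard : ℝ) * ((4 * (ℓ : ℝ)) ^ (b * n) * (2 : ℝ) ^ (η * n)) := by
            rw [Finset.sum_mul]
        _ ≤ ∑ φ ∈ good, (q : ℝ) ^ n := Finset.sum_le_sum hbadcount
        _ = good.card * (q : ℝ) ^ n := by rw [Finset.sum_const, nsmul_eq_mul]
        _ ≤ _ := mul_le_mul_of_nonneg_right h2 (by positivity)
    have h5 : (0 : ℝ) < (4 * (ℓ : ℝ)) ^ (b * n) := by positivity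
    refine le_of_mul_le_mul_left ?_ h5
    calc _ = _ := by ring
      _ ≤ _ := h4
  have hqpos : (0 : ℝ) < q := by
    rw [← hF]; exact_mod_cast Fintype.card_pos
  have hcardfun : ((Fintype.card (Fin n → F)) : ℝ) = (q : ℝ) ^ n := by
    rw [Fintype.card_fun, Fintype.card_fin, hF]; push_cast; rfl
  have hcompl : (({α : Fin n → F | ListRecoverable (RSCode α k) (1 - R - ε) ℓ L}).ncard : ℝ) +
      (({α : Fin n → F | ¬ ListRecoverable (RSCode α k) (1 - R - ε) ℓ L}).ncard : ℝ) = (q : ℝ) ^ n := by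
    rw [← hcardfun, ← Nat.card_eq_fintype_card]
    exact_mod_cast Set.ncard_add_ncard_compl {α : Fin n → F | ListRecoverable (RSCode α k) (1 - R - ε) ℓ L}
  rw [hcardfun, le_div_iff₀ (pow_pos hqpos n)]
  have h2pos : (0 : ℝ) < (2 : ℝ) ^ (η * n) := by positivity
  have hfin : (({α : Fin n → F | ¬ ListRecoverable (RSCode α k) (1 - R - ε) ℓ L}).ncard : ℝ) ≤
      (2 : ℝ) ^ (-(η * (n : ℝ)) : ℝ) * (q : ℝ) ^ n := by
    rw [Real.rpow_neg (by norm_num), ← div_eq_inv_mul, le_div_iff₀ h2pos]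
    exact hbadtotal
  linarith
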